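/- arXiv:1511.07002 — 2 statements merged into one kernel-verified Lean document; each statement's English description precedes it below -/
import Mathlib

section
/- Weighted Hardy inequality: Let α < 1 and β > 1, and define the weight v(q) = (1+|q|)^α for q < 0 and v(q) = (1+|q|)^β for q > 0, with q = r - t for a fixed time t. Then for compactly supported smooth functions f on ℝ², one has ‖ v(q)^{1/2} (1+|q|)^{-1} f ‖_{L²(ℝ²)} ≲ ‖ v(q)^{1/2} ∂_r f ‖_{L²(ℝ²)}, where the L² norms are taken with respect to Lebesgue measure on ℝ². -/
noncomputable section

open MeasureTheory

/-- The weight `v(q) = (1+|q|)^α` for `q < 0` and `(1+|q|)^β` for `q ≥ 0`. -/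
def vwt (α β q : ℝ) : ℝ := if q < 0 then (1 + |q|) ^ α else (1 + |q|) ^ β

theorem vwt_cont (α β : ℝ) : Continuous (vwt α β) := by
  unfold vwt
  have h1 : ∀ γ : ℝ, Continuous fun q : ℝ => (1 + |q|) ^ γ := by
    intro γ
    refine Continuous.rpow_const (by fun_prop) (fun x => Or.inl ?_)
    positivity
  refine Continuous.if ?_ (h1 α) (h1 β)
  intro a ha
  have : a ∈ frontier (Set.Iio (0:ℝ)) := ha
  rw [frontier_Iio] at this
  simp at this
  subst this
  simp

theorem vwt_pos (α β q : ℝ) : 0 < vwt α β q := by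
  unfold vwt
  split_ifs <;> positivity

theorem mwt_deriv (α β q : ℝ) :
    ∃ d : ℝ, HasDerivWithinAt (fun q => vwt α β q * (1 + |q|)⁻¹) d (Set.Ioi q) q ∧
      min (1 - α) (β - 1) * (vwt α β q * ((1 + |q|)⁻¹) ^ 2) ≤ d := by
  have hp : 0 < 1 + |q| := by positivity
  rcases lt_or_ge q 0 with h | h
  · refine ⟨(1 - α) * (vwt α β q * ((1 + |q|)⁻¹) ^ 2), ?_, ?_⟩
    · have hq : 0 < 1 - q := by linarith
      have h1 : HasDerivAt (fun q : ℝ => (1 - q) ^ (α - 1)) (-1 * (α - 1) * (1 - q) ^ (α - 1 - 1)) q :=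
        ((hasDerivAt_id q).const_sub 1).rpow_const (Or.inl hq.ne')
      refine HasDerivAt.hasDerivWithinAt ?_
      have h2 : (fun q => vwt α β q * (1 + |q|)⁻¹) =ᶠ[nhds q] fun q : ℝ => (1 - q) ^ (α - 1) := by
        filter_upwards [Iio_mem_nhds h] with y hy
        have hy' : y < 0 := hy
        have : 0 < 1 - y := by linarith
        simp only [vwt, if_pos hy', abs_of_neg hy', ← sub_eq_add_neg]
        rw [Real.rpow_sub_one this.ne', div_eq_mul_inv]
      refine (h1.congr_of_eventuallyEq h2).congr_deriv ?_
      simp only [vwt, if_pos h, abs_of_neg h, ← sub_eq_add_neg]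
      rw [Real.rpow_sub_one hq.ne', Real.rpow_sub_one hq.ne']
      field_simp
      ring
    · exact mul_le_mul_of_nonneg_right (min_le_left _ _)
        (mul_nonneg (vwt_pos _ _ _).le (by positivity))
  · refine ⟨(β - 1) * (vwt α β q * ((1 + |q|)⁻¹) ^ 2), ?_, ?_⟩
    · have hq : 0 < 1 + q := by linarith
      have h1 : HasDerivAt (fun q : ℝ => (1 + q) ^ (β - 1)) (1 * (β - 1) * (1 + q) ^ (β - 1 - 1)) q :=
        ((hasDerivAt_id q).const_add 1).rpow_const (Or.inl hq.ne')
      have h2 : ∀ y, 0 ≤ y → vwt α β y * (1 + |y|)⁻¹ = (1 + y) ^ (β - 1) := by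
        intro y hy
        have : 0 < 1 + y := by linarith
        simp only [vwt, if_neg hy.not_gt, abs_of_nonneg hy]
        rw [Real.rpow_sub_one this.ne', div_eq_mul_inv]
      refine ((h1.hasDerivWithinAt).congr (fun y hy => h2 y (h.trans (le_of_lt hy))) (h2 q h)).congr_deriv ?_
      simp only [vwt, if_neg h.not_gt, abs_of_nonneg h]
      rw [Real.rpow_sub_one hq.ne', Real.rpow_sub_one hq.ne']
      field_simp
    · exact mul_le_mul_of_nonneg_right (min_le_right _ _)
        (mul_nonneg (vwt_pos _ _ _).le (by positivity))

theorem hardy1 (α β : ℝ) (c : ℝ) (hc : 0 < c) (hcm : c = min (1 - α) (β - 1)) (t R : ℝ) (hR : 0 ≤ R)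
    (g g' : ℝ → ℝ) (hg : ∀ r, HasDerivAt g (g' r) r) (hg' : Continuous g') (hgR : g R = 0) :
    ∫ r in (0:ℝ)..R, (c / 2 * (r * (vwt α β (r - t) * ((1 + |r - t|)⁻¹) ^ 2 * (g r) ^ 2))
      - 2 / c * (r * (vwt α β (r - t) * (g' r) ^ 2))) ≤ 0 := by
  have hgc : Continuous g := continuous_iff_continuousAt.2 fun r => (hg r).continuousAt
  have hv := vwt_cont α β
  have hne : ∀ q : ℝ, 1 + |q| ≠ 0 := fun q => by positivity
  have hinv : Continuous fun r : ℝ => (1 + |r - t|)⁻¹ :=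
    Continuous.inv₀ (by fun_prop) (fun r => hne _)
  have hvt : Continuous fun r : ℝ => vwt α β (r - t) := hv.comp (by fun_prop)
  choose d hd hdm using mwt_deriv α β
  have key := intervalIntegral.integral_le_sub_of_hasDeriv_right_of_le
    (a := 0) (b := R)
    (g := fun r => r * (vwt α β (r - t) * (1 + |r - t|)⁻¹) * (g r) ^ 2)
    (g' := fun r => (1 * (vwt α β (r - t) * (1 + |r - t|)⁻¹) + r * d (r - t)) * (g r) ^ 2
        + r * (vwt α β (r - t) * (1 + |r - t|)⁻¹) * (2 * g r * g' r))
    (φ := fun r => (c / 2 * (r * (vwt α β (r - t) * ((1 + |r - t|)⁻¹) ^ 2 * (g r) ^ 2))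
      - 2 / c * (r * (vwt α β (r - t) * (g' r) ^ 2))))
    hR (by fun_prop) ?_ ?_ ?_
  · simpa [hgR] using key
  · intro r hr
    have h1 : HasDerivWithinAt (fun r => vwt α β (r - t) * (1 + |r - t|)⁻¹) (d (r - t)) (Set.Ioi r) r := by
      have := (hd (r - t)).comp r (h := fun r => r - t) (s := Set.Ioi r) (h' := 1)
        ((hasDerivAt_id r).sub_const t).hasDerivWithinAt (fun y hy => by
          simp only [Set.mem_Ioi] at hy ⊢; linarith)
      simpa [Function.comp_def] using this
    have h2 : HasDerivWithinAt (fun r => g r ^ 2) (2 * g r * g' r) (Set.Ioi r) r := by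
      have h3 := ((hg r).pow 2).hasDerivWithinAt (s := Set.Ioi r)
      refine HasDerivWithinAt.congr_deriv (f := fun r => g r ^ 2) h3 ?_
      simp
    exact ((hasDerivWithinAt_id r _).mul h1).mul h2
  · exact (by fun_prop : Continuous _).integrableOn_Icc
  · intro r hr
    have hr0 : 0 < r := hr.1
    have hv0 := vwt_pos α β (r - t)
    have hd0 := hdm (r - t)
    rw [← hcm] at hd0
    set v := vwt α β (r - t)
    set s := (1 + |r - t|)⁻¹
    have hs : 0 < s := by positivity
    have e1 : 0 ≤ (r * (g r) ^ 2) * (d (r - t) - c * (v * s ^ 2)) :=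
      mul_nonneg (by positivity) (by linarith)
    have e2 : 0 ≤ v * s * (g r)^2 := by positivity
    have e3 : 0 ≤ r * v * (c / 2) * (s * g r + 2 / c * g' r) ^ 2 := by positivity
    have e4 : r * v * (c / 2) * (s * g r + 2 / c * g' r) ^ 2 =
      c / 2 * (r * (v * s ^ 2 * (g r)^2)) + 2 * r * v * s * g r * g' r + 2 / c * (r * (v * (g' r)^2)) := by
      field_simp
      ring
    rw [e4] at e3
    nlinarith [e1, e2, e3]

theorem mp2 : MeasurePreserving (fun p : ℝ × ℝ => (!₂[p.1, p.2] : EuclideanSpace ℝ (Fin 2))) := by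
  have h1 := (volume_preserving_finTwoArrow ℝ).symm
  exact (PiLp.volume_preserving_toLp (Fin 2)).comp h1

theorem emb2 : MeasurableEmbedding (fun p : ℝ × ℝ => (!₂[p.1, p.2] : EuclideanSpace ℝ (Fin 2))) :=
  (MeasurableEquiv.toLp 2 (Fin 2 → ℝ)).measurableEmbedding.comp
    (MeasurableEquiv.finTwoArrow (α := ℝ)).symm.measurableEmbedding

def uvec (θ : ℝ) : EuclideanSpace ℝ (Fin 2) := !₂[Real.cos θ, Real.sin θ]

theorem uvec_norm (θ : ℝ) : ‖uvec θ‖ = 1 := by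
  simp [uvec, EuclideanSpace.norm_eq]

theorem uvec_cont : Continuous uvec := by
  unfold uvec
  refine (PiLp.continuous_toLp 2 _).comp ?_
  refine continuous_pi fun i => ?_
  fin_cases i
  · exact Real.continuous_cos
  · exact Real.continuous_sin

theorem polar2 (F : EuclideanSpace ℝ (Fin 2) → ℝ) :
    ∫ x, F x = ∫ p in Set.Ioi (0:ℝ) ×ˢ Set.Ioo (-Real.pi) Real.pi, p.1 * F (p.1 • uvec p.2) := by
  rw [← mp2.integral_comp emb2, ← integral_comp_polarCoord_symm]
  rw [polarCoord_target]
  refine setIntegral_congr_fun (measurableSet_Ioi.prod measurableSet_Ioo) ?_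
  intro p hp
  simp only [polarCoord_symm_apply, smul_eq_mul]
  congr 2
  ext i
  fin_cases i <;> simp [uvec]

theorem stmt4 (α β : ℝ) (hα : α < 1) (hβ : 1 < β) :
    ∃ C > 0, ∀ t : ℝ, 0 ≤ t → ∀ f : EuclideanSpace ℝ (Fin 2) → ℝ,
      ContDiff ℝ (⊤ : ℕ∞) f → HasCompactSupport f →
      (∫ x : EuclideanSpace ℝ (Fin 2),
          vwt α β (‖x‖ - t) * ((1 + |‖x‖ - t|)⁻¹) ^ 2 * (f x) ^ 2) ≤
        C * ∫ x : EuclideanSpace ℝ (Fin 2),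
          vwt α β (‖x‖ - t) * (fderiv ℝ f x (‖x‖⁻¹ • x)) ^ 2 := by
  obtain ⟨c, hcm⟩ : ∃ c, c = min (1 - α) (β - 1) := ⟨_, rfl⟩
  have hc : 0 < c := by rw [hcm]; exact lt_min (by linarith) (by linarith)
  refine ⟨4 / c ^ 2, by positivity, ?_⟩
  intro t ht f hf hfs
  have hfd : Differentiable ℝ f := hf.differentiable (by simp)
  have hfc : Continuous f := hfd.continuous
  have hf' : Continuous (fderiv ℝ f) := hf.continuous_fderiv (by simp)
  have hu := uvec_cont
  have hv := vwt_cont α β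
  have hne : ∀ q : ℝ, 1 + |q| ≠ 0 := fun q => by positivity
  obtain ⟨R, hR0, hR⟩ : ∃ R : ℝ, 0 ≤ R ∧ ∀ x, R ≤ ‖x‖ → f x = 0 ∧ fderiv ℝ f x = 0 := by
    obtain ⟨R, hR⟩ := (hfs.isCompact.isBounded).subset_ball (0 : EuclideanSpace ℝ (Fin 2))
    refine ⟨max R 0, le_max_right _ _, fun x hx => ?_⟩
    have hx' : x ∉ tsupport f := fun h => by
      have := hR h
      simp only [Metric.mem_ball, dist_zero_right] at this
      exact absurd this (not_lt.2 ((le_max_left _ _).trans hx))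
    refine ⟨image_eq_zero_of_notMem_tsupport hx', ?_⟩
    exact image_eq_zero_of_notMem_tsupport (fun h => hx' (tsupport_fderiv_subset ℝ h))
  have hnorm : ∀ r θ : ℝ, 0 ≤ r → ‖r • uvec θ‖ = r := fun r θ h => by
    rw [norm_smul, uvec_norm, Real.norm_of_nonneg h, mul_one]
  let A : ℝ × ℝ → ℝ := fun p =>
    p.1 * (vwt α β (p.1 - t) * ((1 + |p.1 - t|)⁻¹) ^ 2 * (f (p.1 • uvec p.2)) ^ 2)
  let B : ℝ × ℝ → ℝ := fun p =>
    p.1 * (vwt α β (p.1 - t) * (fderiv ℝ f (p.1 • uvec p.2) (uvec p.2)) ^ 2)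
  have hinv : Continuous fun p : ℝ × ℝ => (1 + |p.1 - t|)⁻¹ :=
    Continuous.inv₀ (by fun_prop) (fun r => hne _)
  have hvt : Continuous fun p : ℝ × ℝ => vwt α β (p.1 - t) := hv.comp (by fun_prop)
  have hA : Continuous A := by fun_prop
  have hB : Continuous B := by fun_prop
  have hsub : Set.Ioc (0:ℝ) R ×ˢ Set.Ioo (-Real.pi) Real.pi ⊆
      Set.Ioi (0:ℝ) ×ˢ Set.Ioo (-Real.pi) Real.pi :=
    Set.prod_mono Set.Ioc_subset_Ioi_self subset_rfl
  have hmI : MeasurableSet (Set.Ioi (0:ℝ) ×ˢ Set.Ioo (-Real.pi) Real.pi) :=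
    measurableSet_Ioi.prod measurableSet_Ioo
  have hbig : ∀ p ∈ (Set.Ioi (0:ℝ) ×ˢ Set.Ioo (-Real.pi) Real.pi) \
      (Set.Ioc (0:ℝ) R ×ˢ Set.Ioo (-Real.pi) Real.pi),
      f (p.1 • uvec p.2) = 0 ∧ fderiv ℝ f (p.1 • uvec p.2) = 0 := by
    rintro ⟨r, θ⟩ ⟨⟨h1, h2⟩, h3⟩
    have h1' : 0 < r := h1
    apply hR
    rw [hnorm _ _ h1'.le]
    by_contra hlt
    exact h3 ⟨⟨h1', (not_le.1 hlt).le⟩, h2⟩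
  have eA : (∫ x : EuclideanSpace ℝ (Fin 2),
      vwt α β (‖x‖ - t) * ((1 + |‖x‖ - t|)⁻¹) ^ 2 * (f x) ^ 2) =
      ∫ p in Set.Ioc (0:ℝ) R ×ˢ Set.Ioo (-Real.pi) Real.pi, A p := by
    rw [polar2, ← setIntegral_eq_of_subset_of_forall_diff_eq_zero hmI hsub]
    · refine setIntegral_congr_fun hmI fun p hp => ?_
      have : 0 < p.1 := hp.1
      simp only [A, hnorm _ _ this.le]
    · intro p hp
      simp [A, (hbig p hp).1]
  have eB : (∫ x : EuclideanSpace ℝ (Fin 2),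
          vwt α β (‖x‖ - t) * (fderiv ℝ f x (‖x‖⁻¹ • x)) ^ 2) =
      ∫ p in Set.Ioc (0:ℝ) R ×ˢ Set.Ioo (-Real.pi) Real.pi, B p := by
    rw [polar2, ← setIntegral_eq_of_subset_of_forall_diff_eq_zero hmI hsub]
    · refine setIntegral_congr_fun hmI fun p hp => ?_
      have : 0 < p.1 := hp.1
      simp only [B, hnorm _ _ this.le]
      rw [smul_smul, inv_mul_cancel₀ this.ne', one_smul]
    · intro p hp
      simp [B, (hbig p hp).2]
  have hint : ∀ G : ℝ × ℝ → ℝ, Continuous G →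
      IntegrableOn G (Set.Ioc (0:ℝ) R ×ˢ Set.Ioo (-Real.pi) Real.pi) := fun G hG =>
    (hG.continuousOn.integrableOn_compact (isCompact_Icc.prod isCompact_Icc)).mono_set
      (Set.prod_mono Set.Ioc_subset_Icc_self Set.Ioo_subset_Icc_self)
  rw [eA, eB]
  have main : ∫ p in Set.Ioc (0:ℝ) R ×ˢ Set.Ioo (-Real.pi) Real.pi,
      (c / 2 * A p - 2 / c * B p) ≤ 0 := by
    have hi := hint (fun p => c / 2 * A p - 2 / c * B p) (by fun_prop)
    rw [IntegrableOn, Measure.volume_eq_prod, ← Measure.prod_restrict] at hi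
    rw [Measure.volume_eq_prod, ← Measure.prod_restrict, integral_prod_symm _ hi]
    refine integral_nonpos fun θ => ?_
    simp only [Pi.zero_apply]
    rw [← intervalIntegral.integral_of_le hR0]
    refine hardy1 α β c hc hcm t R hR0 (fun r => f (r • uvec θ))
      (fun r => fderiv ℝ f (r • uvec θ) (uvec θ)) ?_ (by fun_prop) ?_
    · intro r
      have h1 : HasDerivAt (fun r : ℝ => r • uvec θ) (uvec θ) r := by
        simpa using (hasDerivAt_id r).smul_const (uvec θ)
      exact (hfd (r • uvec θ)).hasFDerivAt.comp_hasDerivAt r h1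
    · exact (hR _ (by rw [hnorm _ _ hR0])).1
  rw [integral_sub ((hint A hA).const_mul _) ((hint B hB).const_mul _),
    integral_const_mul, integral_const_mul] at main
  have : 4 / c ^ 2 * ∫ p in Set.Ioc (0:ℝ) R ×ˢ Set.Ioo (-Real.pi) Real.pi, B p =
    (2 / c) * (2 / c * ∫ p in Set.Ioc (0:ℝ) R ×ˢ Set.Ioo (-Real.pi) Real.pi, B p) := by
    field_simp
    ring
  rw [this]
  have h3 := mul_le_mul_of_nonneg_left (sub_nonpos.1 main) (by positivity : 0 ≤ 2 / c)
  refine le_trans (le_of_eq ?_) h3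
  field_simp

end
end

section
/- Corollary of the L∞–L∞ estimate: Let ρ > 0 and 0 ≤ α ≤ β with β − α ≥ ρ. Suppose u solves □u = f on ℝ^{1+2} with zero initial data, where |f| ≲ (1+s)^{−3/2+α}(1+|q|)^{−1} in the region q < 0 and |f| ≲ (1+s)^{−3/2+α}(1+|q|)^{−1−β} in the region q > 0 (s = t+r, q = r−t). Then |u(t,x)| ≲ (1+t)^{α+ρ} (1+s)^{−1/2}. -/
noncomputable section

/-- Spacetime point `(t, x₁, x₂)` in `ℝ^{2+1}`. -/
abbrev Pt : Type := ℝ × ℝ × ℝ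

def rad (p : Pt) : ℝ := Real.sqrt (p.2.1 ^ 2 + p.2.2 ^ 2)
def svar (p : Pt) : ℝ := p.1 + rad p
def qvar (p : Pt) : ℝ := rad p - p.1

/-- Derivative of `u` along the constant vector `v`. -/
def pd (v : Pt) (u : Pt → ℝ) : Pt → ℝ := fun p => fderiv ℝ u p v

def e0 : Pt := (1, 0, 0)
def e1 : Pt := (0, 1, 0)
def e2 : Pt := (0, 0, 1)

/-- The flat d'Alembertian `□u = -∂_t²u + ∂_1²u + ∂_2²u` on `ℝ^{2+1}`. -/
def Box (u : Pt → ℝ) : Pt → ℝ := fun p =>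
  -pd e0 (pd e0 u) p + pd e1 (pd e1 u) p + pd e2 (pd e2 u) p


open MeasureTheory intervalIntegral in
lemma swap_int (f : ℝ → ℝ → ℝ) (hf : Continuous (Function.uncurry f)) (a b c d : ℝ)
    (hab : a ≤ b) (hcd : c ≤ d) :
    ∫ x in a..b, ∫ y in c..d, f x y = ∫ y in c..d, ∫ x in a..b, f x y := by
  simp only [integral_of_le hab, integral_of_le hcd]
  apply integral_integral_swap
  rw [Measure.prod_restrict]
  apply IntegrableOn.mono_set (t := Set.Icc a b ×ˢ Set.Icc c d)
  · exact hf.continuousOn.integrableOn_compact (isCompact_Icc.prod isCompact_Icc)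
  · exact Set.prod_mono Set.Ioc_subset_Icc_self Set.Ioc_subset_Icc_self

lemma cont_param (f : ℝ → ℝ → ℝ → ℝ) (hf : Continuous (fun z : ℝ × ℝ × ℝ => f z.1 z.2.1 z.2.2))
    (c d : ℝ) : Continuous (Function.uncurry (fun x y => ∫ t in c..d, f x y t)) := by
  have := intervalIntegral.continuous_parametric_intervalIntegral_of_continuous'
    (f := fun (q : ℝ × ℝ) t => f q.1 q.2 t) (μ := MeasureTheory.volume) (a₀ := c) (b₀ := d) 
  apply this
  exact hf.comp (f := fun z : (ℝ × ℝ) × ℝ => (z.1.1, z.1.2, z.2)) (by fun_prop)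

/-- abstract box divergence argument -/
lemma box_div (Ef dE dA dB Af Bf : ℝ → ℝ → ℝ → ℝ) (T : ℝ) (hT : 0 ≤ T)
    (hdE : Continuous (fun z : ℝ × ℝ × ℝ => dE z.1 z.2.1 z.2.2))
    (hdA : Continuous (fun z : ℝ × ℝ × ℝ => dA z.1 z.2.1 z.2.2))
    (hdB : Continuous (fun z : ℝ × ℝ × ℝ => dB z.1 z.2.1 z.2.2))
    (hEf : Continuous (fun z : ℝ × ℝ × ℝ => Ef z.1 z.2.1 z.2.2))
    (h1 : ∀ x y z, HasDerivAt (fun x => Ef x y z) (dE x y z) x)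
    (h2 : ∀ x y z, HasDerivAt (fun y => Af x y z) (dA x y z) y)
    (h3 : ∀ x y z, HasDerivAt (fun z => Bf x y z) (dB x y z) z)
    (hA : ∀ x z, Af x Real.pi z = 0 ∧ Af x 0 z = 0)
    (hB : ∀ x y, Bf x y Real.pi = 0 ∧ Bf x y 0 = 0)
    (hneg : ∀ x ∈ Set.Icc 0 T, ∀ y ∈ Set.Icc 0 Real.pi, ∀ z ∈ Set.Icc 0 Real.pi,
      dE x y z + dA x y z + dB x y z ≤ 0) :
    ∫ y in (0:ℝ)..Real.pi, ∫ z in (0:ℝ)..Real.pi, Ef T y z ≤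
      ∫ y in (0:ℝ)..Real.pi, ∫ z in (0:ℝ)..Real.pi, Ef 0 y z := by
  have hpi := Real.pi_pos.le
  -- slices
  have sl2 : ∀ (g : ℝ → ℝ → ℝ → ℝ), Continuous (fun z : ℝ × ℝ × ℝ => g z.1 z.2.1 z.2.2) → ∀ x,
      Continuous (Function.uncurry (g x)) := fun g hg x =>
    hg.comp (f := fun z : ℝ × ℝ => (x, z.1, z.2)) (by fun_prop)
  have ci : ∀ (g : ℝ → ℝ → ℝ), Continuous (Function.uncurry g) → 
      Continuous (fun x => ∫ z in (0:ℝ)..Real.pi, g x z) := fun g hg =>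
    intervalIntegral.continuous_parametric_intervalIntegral_of_continuous' hg _ _
  have cz : ∀ (g : ℝ → ℝ → ℝ), Continuous (Function.uncurry g) → ∀ x, Continuous (g x) :=
    fun g hg x => hg.comp (f := fun z : ℝ => (x, z)) (by fun_prop)
  -- for each x, the slice integral is nonpositive
  have key : ∀ x ∈ Set.Icc 0 T, 
      ∫ y in (0:ℝ)..Real.pi, ∫ z in (0:ℝ)..Real.pi, dE x y z ≤ 0 := by
    intro x hx
    have eA : ∫ y in (0:ℝ)..Real.pi, ∫ z in (0:ℝ)..Real.pi, dA x y z = 0 := by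
      rw [swap_int _ (sl2 dA hdA x) _ _ _ _ hpi hpi]
      refine (intervalIntegral.integral_congr (g := fun _ => (0:ℝ)) ?_).trans (by simp)
      intro z _
      simp only
      rw [intervalIntegral.integral_eq_sub_of_hasDerivAt (f := fun y => Af x y z)
        (fun y _ => h2 x y z)]
      · simp [hA]
      · apply Continuous.intervalIntegrable
        exact hdA.comp (f := fun y : ℝ => (x, y, z)) (by fun_prop)
    have eB : ∫ y in (0:ℝ)..Real.pi, ∫ z in (0:ℝ)..Real.pi, dB x y z = 0 := by
      refine (intervalIntegral.integral_congr (g := fun _ => (0:ℝ)) ?_).trans (by simp)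
      intro y _
      simp only
      rw [intervalIntegral.integral_eq_sub_of_hasDerivAt (f := fun z => Bf x y z)
        (fun z _ => h3 x y z)]
      · simp [hB]
      · apply Continuous.intervalIntegrable
        exact hdB.comp (f := fun z : ℝ => (x, y, z)) (by fun_prop)
    have e : ∫ y in (0:ℝ)..Real.pi, ∫ z in (0:ℝ)..Real.pi, (dE x y z + dA x y z + dB x y z) =
        (∫ y in (0:ℝ)..Real.pi, ∫ z in (0:ℝ)..Real.pi, dE x y z) + 
        (∫ y in (0:ℝ)..Real.pi, ∫ z in (0:ℝ)..Real.pi, dA x y z) +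
        (∫ y in (0:ℝ)..Real.pi, ∫ z in (0:ℝ)..Real.pi, dB x y z) := by
      have i1 := fun y => (cz _ (sl2 dE hdE x) y).intervalIntegrable (μ := MeasureTheory.volume) 0 Real.pi
      have i2 := fun y => (cz _ (sl2 dA hdA x) y).intervalIntegrable (μ := MeasureTheory.volume) 0 Real.pi
      have i3 := fun y => (cz _ (sl2 dB hdB x) y).intervalIntegrable (μ := MeasureTheory.volume) 0 Real.pi
      have j1 := (ci _ (sl2 dE hdE x)).intervalIntegrable (μ := MeasureTheory.volume) 0 Real.pi
      have j2 := (ci _ (sl2 dA hdA x)).intervalIntegrable (μ := MeasureTheory.volume) 0 Real.pi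
      have j3 := (ci _ (sl2 dB hdB x)).intervalIntegrable (μ := MeasureTheory.volume) 0 Real.pi
      rw [← intervalIntegral.integral_add j1 j2, ← intervalIntegral.integral_add (j1.add j2) j3]
      apply intervalIntegral.integral_congr
      intro y _
      simp only
      rw [intervalIntegral.integral_add ((i1 y).add (i2 y)) (i3 y), 
        intervalIntegral.integral_add (i1 y) (i2 y)]
    have n : ∫ y in (0:ℝ)..Real.pi, ∫ z in (0:ℝ)..Real.pi, (dE x y z + dA x y z + dB x y z) ≤ 0 := by
      have := intervalIntegral.integral_nonneg (μ := MeasureTheory.volume) hpi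
        (f := fun y => - ∫ z in (0:ℝ)..Real.pi, (dE x y z + dA x y z + dB x y z)) (by
          intro y hy
          have := intervalIntegral.integral_nonneg (μ := MeasureTheory.volume) hpi
            (f := fun z => - (dE x y z + dA x y z + dB x y z)) (fun z hz => by
              have := hneg x hx y hy z hz
              linarith)
          rwa [intervalIntegral.integral_neg] at this)
      rw [intervalIntegral.integral_neg] at this
      linarith
    linarith
  have main : ∫ x in (0:ℝ)..T, ∫ y in (0:ℝ)..Real.pi, ∫ z in (0:ℝ)..Real.pi, dE x y z =
      (∫ y in (0:ℝ)..Real.pi, ∫ z in (0:ℝ)..Real.pi, Ef T y z) -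
      ∫ y in (0:ℝ)..Real.pi, ∫ z in (0:ℝ)..Real.pi, Ef 0 y z := by
    rw [swap_int _ (cont_param dE hdE 0 Real.pi) _ _ _ _ hT hpi]
    have j1 := (ci _ (sl2 Ef hEf T)).intervalIntegrable (μ := MeasureTheory.volume) 0 Real.pi
    have j2 := (ci _ (sl2 Ef hEf 0)).intervalIntegrable (μ := MeasureTheory.volume) 0 Real.pi
    rw [← intervalIntegral.integral_sub j1 j2]
    apply intervalIntegral.integral_congr
    intro y _
    simp only
    have c1 : Continuous (Function.uncurry fun x z => dE x y z) :=
      hdE.comp (f := fun z : ℝ × ℝ => (z.1, y, z.2)) (by fun_prop)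
    rw [swap_int _ c1 _ _ _ _ hT hpi]
    rw [← intervalIntegral.integral_sub 
      ((cz _ (sl2 Ef hEf T) y).intervalIntegrable 0 Real.pi)
      ((cz _ (sl2 Ef hEf 0) y).intervalIntegrable 0 Real.pi)]
    apply intervalIntegral.integral_congr
    intro z _
    simp only
    rw [intervalIntegral.integral_eq_sub_of_hasDerivAt (f := fun x => Ef x y z)
        (fun x _ => h1 x y z)]
    apply Continuous.intervalIntegrable
    exact hdE.comp (f := fun x : ℝ => (x, y, z)) (by fun_prop)
  have := intervalIntegral.integral_nonneg (μ := MeasureTheory.volume) hT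
    (f := fun x => - ∫ y in (0:ℝ)..Real.pi, ∫ z in (0:ℝ)..Real.pi, dE x y z) (fun x hx => by
      have := key x hx
      linarith)
  rw [intervalIntegral.integral_neg, main] at this
  linarith


lemma clm_expand {F : Type*} [NormedAddCommGroup F] [NormedSpace ℝ F] (L : Pt →L[ℝ] F) (a b c : ℝ) :
    L (a, b, c) = a • L e0 + b • L e1 + c • L e2 := by
  rw [← map_smul, ← map_smul, ← map_smul, ← map_add, ← map_add]
  simp [e0, e1, e2]

lemma pd_pd (w : Pt → ℝ) (hw : ContDiff ℝ 2 w) (v z : Pt) (p : Pt) :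
    pd z (pd v w) p = fderiv ℝ (fderiv ℝ w) p z v := by
  have h1 : ContDiff ℝ 1 (fderiv ℝ w) := hw.fderiv_right (by norm_num)
  have h2 : DifferentiableAt ℝ (fderiv ℝ w) p := (h1.differentiable (by norm_num)) p
  unfold pd
  rw [fderiv_clm_apply h2 (differentiableAt_const v)]
  simp

lemma clm_exp1 (L : Pt →L[ℝ] ℝ) : ∃ w0 w1 w2 : ℝ, ∀ a b c : ℝ,
    L (a, b, c) = a * w0 + b * w1 + c * w2 :=
  ⟨L e0, L e1, L e2, fun a b c => by rw [clm_expand]; simp⟩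

lemma clm_exp2 (H : Pt →L[ℝ] Pt →L[ℝ] ℝ) (hs : ∀ v z, H v z = H z v) :
    ∃ h00 h01 h02 h11 h12 h22 : ℝ, ∀ a b c a' b' c' : ℝ,
    H (a, b, c) (a', b', c') = a * a' * h00 + (a * b' + b * a') * h01 + (a * c' + c * a') * h02
      + b * b' * h11 + (b * c' + c * b') * h12 + c * c' * h22 :=
  ⟨H e0 e0, H e0 e1, H e0 e2, H e1 e1, H e1 e2, H e2 e2, fun a b c a' b' c' => by
    rw [clm_expand H a b c]
    simp only [add_apply, smul_apply]
    rw [clm_expand (H e0), clm_expand (H e1), clm_expand (H e2), hs e1 e0, hs e2 e0, hs e2 e1]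
    simp only [smul_eq_mul]
    ring⟩

/-- points on the backward cone -/
def X (t0 x1 x2 a1 a2 ρ φ θ : ℝ) : Pt :=
  (t0 - ρ, x1 + ρ * (Real.cos φ * a1 - Real.sin φ * Real.cos θ * a2),
    x2 + ρ * (Real.cos φ * a2 + Real.sin φ * Real.cos θ * a1))

def om (a1 a2 φ θ k : ℝ) : Pt :=
  (k, Real.cos φ * a1 - Real.sin φ * Real.cos θ * a2,
    Real.cos φ * a2 + Real.sin φ * Real.cos θ * a1)

set_option maxHeartbeats 2000000 in
lemma comparison (w : Pt → ℝ) (hw : ContDiff ℝ 2 w) (t0 x1 x2 a1 a2 : ℝ) (ht0 : 0 ≤ t0)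
    (ha : a1 ^ 2 + a2 ^ 2 = 1)
    (hbox : ∀ p : Pt, 0 ≤ p.1 → p.1 ≤ t0 →
      (p.2.1 - x1) ^ 2 + (p.2.2 - x2) ^ 2 ≤ (t0 - p.1) ^ 2 → Box w p ≤ 0) :
    ∫ φ in (0:ℝ)..Real.pi, ∫ θ in (0:ℝ)..Real.pi, Real.sin φ * 
      (w (X t0 x1 x2 a1 a2 t0 φ θ) + 
        t0 * fderiv ℝ w (X t0 x1 x2 a1 a2 t0 φ θ) (om a1 a2 φ θ 1)) ≤
     2 * Real.pi * w (t0, x1, x2) := by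
  have hW1 : ContDiff ℝ 1 (fderiv ℝ w) := hw.fderiv_right (by norm_num)
  have hWd : ∀ p, HasFDerivAt w (fderiv ℝ w p) p := fun p =>
    ((hw.differentiable (by norm_num)) p).hasFDerivAt
  have hHd : ∀ p, HasFDerivAt (fderiv ℝ w) (fderiv ℝ (fderiv ℝ w) p) p := fun p =>
    ((hW1.differentiable (by norm_num)) p).hasFDerivAt
  have hWc : Continuous (fderiv ℝ w) := hW1.continuous
  have hHc : Continuous (fderiv ℝ (fderiv ℝ w)) := hW1.continuous_fderiv (by norm_num)
  have hwc : Continuous w := hw.continuous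
  have hsymm : ∀ p v z, fderiv ℝ (fderiv ℝ w) p v z = fderiv ℝ (fderiv ℝ w) p z v := fun p v z =>
    (hw.contDiffAt.isSymmSndFDerivAt (by simp)) v z
  set XX := X t0 x1 x2 a1 a2 with hXX
  have hXc : Continuous (fun z : ℝ × ℝ × ℝ => XX z.1 z.2.1 z.2.2) := by
    simp only [hXX, X]; fun_prop
  have homc : ∀ k, Continuous (fun z : ℝ × ℝ × ℝ => om a1 a2 z.2.1 z.2.2 k) := by
    intro k; simp only [om]; fun_prop
  let omφ : ℝ → ℝ → Pt := fun φ θ => (0, -Real.sin φ * a1 - Real.cos φ * Real.cos θ * a2,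
    -Real.sin φ * a2 + Real.cos φ * Real.cos θ * a1)
  have homφc : Continuous (fun z : ℝ × ℝ × ℝ => omφ z.2.1 z.2.2) := by
    simp only [omφ]; fun_prop
  have hX1 : ∀ ρ φ θ, HasDerivAt (fun ρ => XX ρ φ θ) (om a1 a2 φ θ (-1)) ρ := by
    intro ρ φ θ
    simp only [hXX, X, om]
    refine HasDerivAt.prodMk ?_ (HasDerivAt.prodMk ?_ ?_)
    · simpa using (hasDerivAt_id ρ).const_sub t0
    · simpa using ((hasDerivAt_id ρ).mul_const _).const_add x1
    · simpa using ((hasDerivAt_id ρ).mul_const _).const_add x2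
  have hX2 : ∀ ρ φ θ, HasDerivAt (fun φ => XX ρ φ θ) (ρ • omφ φ θ) φ := by
    intro ρ φ θ
    simp only [hXX, X, omφ, Prod.smul_mk, smul_eq_mul]
    refine HasDerivAt.prodMk ?_ (HasDerivAt.prodMk ?_ ?_)
    · simpa using hasDerivAt_const φ (t0 - ρ)
    · exact (((((Real.hasDerivAt_cos φ).mul_const a1).sub 
        (((Real.hasDerivAt_sin φ).mul_const (Real.cos θ)).mul_const a2)).const_mul ρ).const_add x1)
    · exact (((((Real.hasDerivAt_cos φ).mul_const a2).add 
        (((Real.hasDerivAt_sin φ).mul_const (Real.cos θ)).mul_const a1)).const_mul ρ).const_add x2)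
  have hX3 : ∀ ρ φ θ, HasDerivAt (fun θ => XX ρ φ θ) 
      ((-ρ * Real.sin φ * Real.sin θ) • ((0, -a2, a1) : Pt)) θ := by
    intro ρ φ θ
    simp only [hXX, X, Prod.smul_mk, smul_eq_mul]
    refine HasDerivAt.prodMk ?_ (HasDerivAt.prodMk ?_ ?_)
    · simpa using hasDerivAt_const θ (t0 - ρ)
    · convert (((((Real.hasDerivAt_cos θ).const_mul (Real.sin φ)).mul_const a2).const_sub 
        (Real.cos φ * a1)).const_mul ρ).const_add x1 using 1
      ring
    · convert (((((Real.hasDerivAt_cos θ).const_mul (Real.sin φ)).mul_const a1).const_add 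
        (Real.cos φ * a2)).const_mul ρ).const_add x2 using 1
      ring
  have homφd : ∀ φ θ, HasDerivAt (fun φ => omφ φ θ) (-(om a1 a2 φ θ 0)) φ := by
    intro φ θ
    simp only [omφ, om, Prod.neg_mk]
    refine HasDerivAt.prodMk ?_ (HasDerivAt.prodMk ?_ ?_)
    · simpa using hasDerivAt_const φ (0:ℝ)
    · exact (((Real.hasDerivAt_sin φ).neg.mul_const a1).sub 
        (((Real.hasDerivAt_cos φ).mul_const (Real.cos θ)).mul_const a2)).congr_deriv (by ring)
    · exact (((Real.hasDerivAt_sin φ).neg.mul_const a2).add 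
        (((Real.hasDerivAt_cos φ).mul_const (Real.cos θ)).mul_const a1)).congr_deriv (by ring)
  let W := fderiv ℝ w
  let H := fderiv ℝ W
  let Ef : ℝ → ℝ → ℝ → ℝ := fun ρ φ θ => Real.sin φ * (w (XX ρ φ θ) + ρ * W (XX ρ φ θ) (om a1 a2 φ θ 1))
  let dE : ℝ → ℝ → ℝ → ℝ := fun ρ φ θ => Real.sin φ * (W (XX ρ φ θ) (om a1 a2 φ θ (-1)) + 
    (W (XX ρ φ θ) (om a1 a2 φ θ 1) + ρ * H (XX ρ φ θ) (om a1 a2 φ θ (-1)) (om a1 a2 φ θ 1)))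
  let Af : ℝ → ℝ → ℝ → ℝ := fun ρ φ θ => Real.sin φ * W (XX ρ φ θ) (omφ φ θ)
  let dA : ℝ → ℝ → ℝ → ℝ := fun ρ φ θ => Real.cos φ * W (XX ρ φ θ) (omφ φ θ) + 
    Real.sin φ * (H (XX ρ φ θ) (ρ • omφ φ θ) (omφ φ θ) + W (XX ρ φ θ) (-(om a1 a2 φ θ 0)))
  let Bf : ℝ → ℝ → ℝ → ℝ := fun ρ φ θ => - Real.sin θ * W (XX ρ φ θ) (0, -a2, a1)
  let dB : ℝ → ℝ → ℝ → ℝ := fun ρ φ θ => - Real.cos θ * W (XX ρ φ θ) (0, -a2, a1) + 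
    - Real.sin θ * H (XX ρ φ θ) ((-ρ * Real.sin φ * Real.sin θ) • ((0, -a2, a1) : Pt)) (0, -a2, a1)
  have cW := hWc.comp hXc
  have cH := hHc.comp hXc
  have cw := hwc.comp hXc
  have cs : Continuous (fun z : ℝ × ℝ × ℝ => Real.sin z.2.1) := by fun_prop
  have cc : Continuous (fun z : ℝ × ℝ × ℝ => Real.cos z.2.1) := by fun_prop
  have cs3 : Continuous (fun z : ℝ × ℝ × ℝ => Real.sin z.2.2) := by fun_prop
  have cc3 : Continuous (fun z : ℝ × ℝ × ℝ => Real.cos z.2.2) := by fun_prop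
  have c1 : Continuous (fun z : ℝ × ℝ × ℝ => z.1) := by fun_prop
  have res := box_div Ef dE dA dB Af Bf t0 ht0 
    (cs.mul ((cW.clm_apply (homc (-1))).add ((cW.clm_apply (homc 1)).add 
      (c1.mul ((cH.clm_apply (homc (-1))).clm_apply (homc 1))))))
    ((cc.mul (cW.clm_apply homφc)).add (cs.mul (((cH.clm_apply (c1.smul homφc)).clm_apply homφc).add
      (cW.clm_apply (homc 0).neg))))
    ((cc3.neg.mul (cW.clm_apply continuous_const)).add (cs3.neg.mul 
      ((cH.clm_apply (((c1.neg.mul cs).mul cs3).smul continuous_const)).clm_apply continuous_const)))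
    (cs.mul (cw.add (c1.mul (cW.clm_apply (homc 1)))))
    (by
      intro ρ φ θ
      have d1 := (hWd (XX ρ φ θ)).comp_hasDerivAt ρ (hX1 ρ φ θ)
      have d2 := ((hHd (XX ρ φ θ)).comp_hasDerivAt ρ (hX1 ρ φ θ)).clm_apply
        (hasDerivAt_const ρ (om a1 a2 φ θ 1))
      refine ((d1.add ((hasDerivAt_id ρ).mul d2)).const_mul (Real.sin φ)).congr_deriv ?_
      simp [dE, W, H])
    (by
      intro ρ φ θ
      have d2 := ((hHd (XX ρ φ θ)).comp_hasDerivAt φ (hX2 ρ φ θ)).clm_apply (homφd φ θ)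
      exact (Real.hasDerivAt_sin φ).mul d2)
    (by
      intro ρ φ θ
      have d2 := ((hHd (XX ρ φ θ)).comp_hasDerivAt θ (hX3 ρ φ θ)).clm_apply
        (hasDerivAt_const θ ((0, -a2, a1) : Pt))
      refine ((Real.hasDerivAt_sin θ).neg.mul d2).congr_deriv ?_
      simp [dB, W, H])
    (by intro ρ θ; simp [Af])
    (by intro ρ θ; simp [Bf])
    (by
      intro ρ hρ φ hφ θ hθ
      have hsn : 0 ≤ Real.sin φ := Real.sin_nonneg_of_mem_Icc hφ
      have e1' := Real.sin_sq_add_cos_sq φ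
      have e2' := Real.sin_sq_add_cos_sq θ
      have hb : Box w (XX ρ φ θ) ≤ 0 := by
        apply hbox
        · simp [hXX, X]; exact hρ.2
        · simp [hXX, X]; exact hρ.1
        · simp only [hXX, X]
          have : (Real.sin φ * Real.cos θ)^2 ≤ Real.sin φ ^ 2 := by
            rw [mul_pow]
            nlinarith [sq_nonneg (Real.sin φ), sq_nonneg (Real.sin θ), mul_nonneg (sq_nonneg (Real.sin φ)) (sq_nonneg (Real.sin θ))]
          have e3 : (x1 + ρ * (Real.cos φ * a1 - Real.sin φ * Real.cos θ * a2) - x1) ^ 2 +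
            (x2 + ρ * (Real.cos φ * a2 + Real.sin φ * Real.cos θ * a1) - x2) ^ 2 =
            ρ^2 * (Real.cos φ ^2 + (Real.sin φ * Real.cos θ)^2) * (a1^2+a2^2) := by ring
          rw [e3, ha]
          have : ρ^2 * (Real.cos φ ^2 + (Real.sin φ * Real.cos θ)^2) ≤ ρ^2 * 1 := by
            apply mul_le_mul_of_nonneg_left _ (sq_nonneg _)
            linarith
          have e4 : (t0 - (t0 - ρ))^2 = ρ^2 * 1 := by ring
          rw [e4]; linarith
      have hid : dE ρ φ θ + dA ρ φ θ + dB ρ φ θ = ρ * Real.sin φ * Box w (XX ρ φ θ) := by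
        obtain ⟨w0, w1, w2, gW⟩ := clm_exp1 (fderiv ℝ w (XX ρ φ θ))
        obtain ⟨h00, h01, h02, h11, h12, h22, gH⟩ := clm_exp2 (fderiv ℝ (fderiv ℝ w) (XX ρ φ θ))
          (hsymm _)
        simp only [Box, pd_pd w hw]
        simp only [dE, dA, dB, om, omφ]
        simp only [H, W, Prod.smul_mk, Prod.neg_mk, smul_eq_mul, e0, e1, e2, gW, gH]
        linear_combination (Real.cos θ * (-a2 * w1 + a1 * w2) + ρ * Real.sin φ * 
          ((a1^2*h11+2*a1*a2*h12+a2^2*h22) + (a2^2*h11-2*a1*a2*h12+a1^2*h22) * Real.cos θ ^ 2)) * e1' +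
          (ρ * Real.sin φ * (a2^2*h11-2*a1*a2*h12+a1^2*h22)) * e2' + (ρ * Real.sin φ * (h11 + h22)) * ha
      rw [hid]
      exact mul_nonpos_of_nonneg_of_nonpos (mul_nonneg hρ.1 hsn) hb)
  refine res.trans (le_of_eq ?_)
  have : ∀ φ θ, Ef 0 φ θ = Real.sin φ * w (t0, x1, x2) := by
    intro φ θ; simp [Ef, hXX, X]
  simp only [this]
  simp
  ring


lemma pd0_slice (g : Pt → ℝ) (p : Pt) (d : ℝ) (hg : DifferentiableAt ℝ g p)
    (h : HasDerivAt (fun z => g (z, p.2.1, p.2.2)) d p.1) : pd e0 g p = d := by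
  have hc : HasDerivAt (fun z : ℝ => ((z, p.2.1, p.2.2) : Pt)) e0 p.1 :=
    (hasDerivAt_id p.1).prodMk ((hasDerivAt_const _ _).prodMk (hasDerivAt_const _ _))
  exact (HasFDerivAt.comp_hasDerivAt (f := fun z : ℝ => ((z, p.2.1, p.2.2) : Pt)) p.1 hg.hasFDerivAt hc).unique h

lemma pd1_slice (g : Pt → ℝ) (p : Pt) (d : ℝ) (hg : DifferentiableAt ℝ g p)
    (h : HasDerivAt (fun z => g (p.1, z, p.2.2)) d p.2.1) : pd e1 g p = d := by
  have hc : HasDerivAt (fun z : ℝ => ((p.1, z, p.2.2) : Pt)) e1 p.2.1 :=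
    (hasDerivAt_const _ _).prodMk ((hasDerivAt_id _).prodMk (hasDerivAt_const _ _))
  exact (hg.hasFDerivAt.comp_hasDerivAt p.2.1 hc).unique h

lemma pd2_slice (g : Pt → ℝ) (p : Pt) (d : ℝ) (hg : DifferentiableAt ℝ g p)
    (h : HasDerivAt (fun z => g (p.1, p.2.1, z)) d p.2.2) : pd e2 g p = d := by
  have hc : HasDerivAt (fun z : ℝ => ((p.1, p.2.1, z) : Pt)) e2 p.2.2 :=
    (hasDerivAt_const _ _).prodMk ((hasDerivAt_const _ _).prodMk (hasDerivAt_id _))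
  exact (hg.hasFDerivAt.comp_hasDerivAt p.2.2 hc).unique h

def RR (p : Pt) : ℝ := Real.sqrt (1 + p.2.1 ^ 2 + p.2.2 ^ 2)
def br (y : ℝ) : ℝ := Real.sqrt (1 + y ^ 2)
def VV (ε k : ℝ) (p : Pt) : ℝ :=
  Real.exp (-ε * Real.arsinh (RR p - p.1) - k * Real.arsinh (RR p + p.1))
def JJ (ε k : ℝ) (p : Pt) : ℝ := ε * (br (RR p - p.1))⁻¹ - k * (br (RR p + p.1))⁻¹
def HH (ε k : ℝ) (p : Pt) : ℝ := -(ε * (br (RR p - p.1))⁻¹ + k * (br (RR p + p.1))⁻¹)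

lemma br_pos (y : ℝ) : 0 < br y := Real.sqrt_pos.2 (by positivity)
lemma RR_pos (p : Pt) : 0 < RR p := Real.sqrt_pos.2 (by positivity)
lemma br_sq (y : ℝ) : br y ^ 2 = 1 + y ^ 2 := Real.sq_sqrt (by positivity)
lemma RR_sq (p : Pt) : RR p ^ 2 = 1 + p.2.1 ^ 2 + p.2.2 ^ 2 := Real.sq_sqrt (by positivity)

lemma br_contDiff : ContDiff ℝ 2 br := by
  unfold br
  exact ContDiff.sqrt (by fun_prop) (fun y => by positivity)
lemma RR_contDiff : ContDiff ℝ 2 RR := by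
  unfold RR
  exact ContDiff.sqrt (by fun_prop) (fun y => by positivity)
lemma brm_contDiff : ContDiff ℝ 2 (fun p : Pt => (br (RR p - p.1))⁻¹) :=
  ContDiff.inv (br_contDiff.comp (RR_contDiff.sub contDiff_fst)) (fun p => (br_pos _).ne')
lemma brp_contDiff : ContDiff ℝ 2 (fun p : Pt => (br (RR p + p.1))⁻¹) :=
  ContDiff.inv (br_contDiff.comp (RR_contDiff.add contDiff_fst)) (fun p => (br_pos _).ne')
lemma VV_contDiff (ε k : ℝ) : ContDiff ℝ 2 (VV ε k) := by
  unfold VV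
  exact ((contDiff_const.mul (RR_contDiff.sub contDiff_fst).arsinh).sub
    (contDiff_const.mul (RR_contDiff.add contDiff_fst).arsinh)).exp
lemma JJ_contDiff (ε k : ℝ) : ContDiff ℝ 2 (JJ ε k) :=
  (contDiff_const.mul brm_contDiff).sub (contDiff_const.mul brp_contDiff)
lemma HH_contDiff (ε k : ℝ) : ContDiff ℝ 2 (HH ε k) :=
  ((contDiff_const.mul brm_contDiff).add (contDiff_const.mul brp_contDiff)).neg

lemma br_deriv (y y' : ℝ → ℝ) (z : ℝ) (d : ℝ) (h : HasDerivAt y d z) :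
    HasDerivAt (fun z => (br (y z))⁻¹) (-(y z) * d * (br (y z))⁻¹ ^ 3) z := by
  have h1 : HasDerivAt (fun z => br (y z)) (y z * d / br (y z)) z := by
    have := ((h.pow 2).const_add 1).sqrt (by simp only [Pi.pow_apply]; positivity)
    refine this.congr_deriv ?_
    have := (br_pos (y z)).ne'
    unfold br at *
    simp
    field_simp
  refine (h1.inv (br_pos _).ne').congr_deriv ?_
  have := (br_pos (y z)).ne'
  field_simp

lemma V_deriv (ε k : ℝ) (a b : ℝ → ℝ) (z a' b' : ℝ) (ha : HasDerivAt a a' z) (hb : HasDerivAt b b' z) :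
    HasDerivAt (fun z => Real.exp (-ε * Real.arsinh (a z) - k * Real.arsinh (b z)))
      (Real.exp (-ε * Real.arsinh (a z) - k * Real.arsinh (b z)) * 
        (-ε * (br (a z))⁻¹ * a' - k * (br (b z))⁻¹ * b')) z := by
  refine (((ha.arsinh).const_mul (-ε)).sub ((hb.arsinh).const_mul k)).exp.congr_deriv ?_
  simp [br]
  ring

lemma RR_deriv1 (p : Pt) : HasDerivAt (fun z => RR (p.1, z, p.2.2)) (p.2.1 / RR p) p.2.1 := by
  have := ((((hasDerivAt_id p.2.1).pow 2).const_add 1).add_const (p.2.2 ^ 2)).sqrt (by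
    simp; positivity)
  refine this.congr_deriv ?_
  have := (RR_pos p).ne'
  unfold RR at *
  simp
  field_simp

lemma RR_deriv2 (p : Pt) : HasDerivAt (fun z => RR (p.1, p.2.1, z)) (p.2.2 / RR p) p.2.2 := by
  have := (((hasDerivAt_id p.2.2).pow 2).const_add (1 + p.2.1 ^ 2)).sqrt (by
    simp; positivity)
  refine this.congr_deriv ?_
  have := (RR_pos p).ne'
  unfold RR at *
  simp
  field_simp

lemma VV_pd0 (ε k : ℝ) : pd e0 (VV ε k) = fun p => VV ε k p * JJ ε k p := by
  funext p
  apply pd0_slice _ _ _ (((VV_contDiff ε k).differentiable (by norm_num)) p)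
  have h := V_deriv ε k (fun z => RR p - z) (fun z => RR p + z) p.1 (-1) 1
    ((hasDerivAt_id _).const_sub _) ((hasDerivAt_id _).const_add _)
  refine h.congr_deriv ?_
  simp only [VV, JJ]; ring

lemma VV_pd1 (ε k : ℝ) : pd e1 (VV ε k) = fun p => VV ε k p * HH ε k p * (p.2.1 / RR p) := by
  funext p
  apply pd1_slice _ _ _ (((VV_contDiff ε k).differentiable (by norm_num)) p)
  have h := V_deriv ε k (fun z => RR (p.1, z, p.2.2) - p.1) (fun z => RR (p.1, z, p.2.2) + p.1) p.2.1 _ _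
    ((RR_deriv1 p).sub_const _) ((RR_deriv1 p).add_const _)
  refine h.congr_deriv ?_
  simp only [VV, HH]; ring

lemma VV_pd2 (ε k : ℝ) : pd e2 (VV ε k) = fun p => VV ε k p * HH ε k p * (p.2.2 / RR p) := by
  funext p
  apply pd2_slice _ _ _ (((VV_contDiff ε k).differentiable (by norm_num)) p)
  have h := V_deriv ε k (fun z => RR (p.1, p.2.1, z) - p.1) (fun z => RR (p.1, p.2.1, z) + p.1) p.2.2 _ _
    ((RR_deriv2 p).sub_const _) ((RR_deriv2 p).add_const _)
  refine h.congr_deriv ?_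
  simp only [VV, HH]; ring

def JP (ε k : ℝ) (p : Pt) : ℝ := ε * (RR p - p.1) * (br (RR p - p.1))⁻¹ ^ 3 +
  k * (RR p + p.1) * (br (RR p + p.1))⁻¹ ^ 3

lemma VV_pd00 (ε k : ℝ) (p : Pt) : pd e0 (pd e0 (VV ε k)) p = 
    VV ε k p * (JJ ε k p ^ 2 + JP ε k p) := by
  rw [VV_pd0]
  apply pd0_slice _ _ _ ((((VV_contDiff ε k).mul (JJ_contDiff ε k)).differentiable (by norm_num)) p)
  have h := V_deriv ε k (fun z => RR p - z) (fun z => RR p + z) p.1 (-1) 1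
    ((hasDerivAt_id _).const_sub _) ((hasDerivAt_id _).const_add _)
  have h2 := br_deriv (fun z => RR p - z) 0 p.1 (-1) ((hasDerivAt_id _).const_sub _)
  have h3 := br_deriv (fun z => RR p + z) 0 p.1 (1) ((hasDerivAt_id _).const_add _)
  refine (h.mul ((h2.const_mul ε).sub (h3.const_mul k))).congr_deriv ?_
  simp only [VV, JJ, JP, Pi.sub_apply]; ring

lemma VV_pd11 (ε k : ℝ) (p : Pt) : pd e1 (pd e1 (VV ε k)) p = 
    VV ε k p * ((HH ε k p ^ 2 + JP ε k p) * (p.2.1 ^ 2 / RR p ^ 2) + 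
      HH ε k p * (1 / RR p - p.2.1 ^ 2 / RR p ^ 3)) := by
  rw [VV_pd1]
  have hx : ContDiff ℝ 2 (fun p : Pt => p.2.1 / RR p) := 
    ContDiff.div (by fun_prop) RR_contDiff (fun p => (RR_pos p).ne')
  apply pd1_slice _ _ _ (((((VV_contDiff ε k).mul (HH_contDiff ε k)).mul hx).differentiable (by norm_num)) p)
  have h1 := RR_deriv1 p
  have h := V_deriv ε k (fun z => RR (p.1, z, p.2.2) - p.1) (fun z => RR (p.1, z, p.2.2) + p.1) p.2.1 _ _
    (h1.sub_const _) (h1.add_const _)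
  have h2 := br_deriv (fun z => RR (p.1, z, p.2.2) - p.1) 0 p.2.1 _ (h1.sub_const _)
  have h3 := br_deriv (fun z => RR (p.1, z, p.2.2) + p.1) 0 p.2.1 _ (h1.add_const _)
  have hR := (RR_pos p).ne'
  refine ((h.mul ((h2.const_mul ε).add (h3.const_mul k)).neg).mul 
    ((hasDerivAt_id _).div h1 hR)).congr_deriv ?_
  simp only [VV, HH, JP, Pi.add_apply, Pi.mul_apply, Pi.neg_apply, id, Pi.div_apply]
  field_simp
  ring

lemma VV_pd22 (ε k : ℝ) (p : Pt) : pd e2 (pd e2 (VV ε k)) p = 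
    VV ε k p * ((HH ε k p ^ 2 + JP ε k p) * (p.2.2 ^ 2 / RR p ^ 2) + 
      HH ε k p * (1 / RR p - p.2.2 ^ 2 / RR p ^ 3)) := by
  rw [VV_pd2]
  have hx : ContDiff ℝ 2 (fun p : Pt => p.2.2 / RR p) := 
    ContDiff.div (by fun_prop) RR_contDiff (fun p => (RR_pos p).ne')
  apply pd2_slice _ _ _ (((((VV_contDiff ε k).mul (HH_contDiff ε k)).mul hx).differentiable (by norm_num)) p)
  have h1 := RR_deriv2 p
  have h := V_deriv ε k (fun z => RR (p.1, p.2.1, z) - p.1) (fun z => RR (p.1, p.2.1, z) + p.1) p.2.2 _ _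
    (h1.sub_const _) (h1.add_const _)
  have h2 := br_deriv (fun z => RR (p.1, p.2.1, z) - p.1) 0 p.2.2 _ (h1.sub_const _)
  have h3 := br_deriv (fun z => RR (p.1, p.2.1, z) + p.1) 0 p.2.2 _ (h1.add_const _)
  have hR := (RR_pos p).ne'
  refine ((h.mul ((h2.const_mul ε).add (h3.const_mul k)).neg).mul 
    ((hasDerivAt_id _).div h1 hR)).congr_deriv ?_
  simp only [VV, HH, JP, Pi.add_apply, Pi.mul_apply, Pi.neg_apply, id, Pi.div_apply]
  field_simp
  ring

lemma super_alg (ε k Q S R q s : ℝ) (hε : 0 < ε) (hk : k = 1/2 - ε) (h5 : 5 * ε ≤ k) (hQ : 0 < Q) (hS : 0 < S)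
    (hR : 1 ≤ R) (hQ2 : Q ^ 2 = 1 + q ^ 2) (hS2 : S ^ 2 = 1 + s ^ 2) (hs : s = 2 * R - q) (hs0 : 0 ≤ s) :
    0 ≤ ε * S + k * Q - 2 * ε * R + ε * q * S / (Q ^ 2 * R) := by
  have a1 : |q| ≤ Q := abs_le_of_sq_le_sq (by linarith) hQ.le
  have a2 : s ≤ S := by nlinarith
  have a3 : 1 ≤ Q := by nlinarith [sq_nonneg q]
  have a4 : S ≤ 1 + s := by nlinarith
  have a5 := neg_abs_le q
  have a5' := le_abs_self q
  have a6 : S ≤ 4 * (R * Q) := by nlinarith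
  have a7 : -4 ≤ q * S / (Q ^ 2 * R) := by
    rw [le_div_iff₀ (by positivity)]
    have : |q| * S ≤ Q * (4 * (R * Q)) := mul_le_mul a1 a6 hS.le hQ.le
    nlinarith
  have a8 : ε * q * S / (Q ^ 2 * R) = ε * (q * S / (Q ^ 2 * R)) := by ring
  rw [a8]
  have a9 : ε * (-4) ≤ ε * (q * S / (Q ^ 2 * R)) := mul_le_mul_of_nonneg_left a7 hε.le
  have a10 : ε * s ≤ ε * S := mul_le_mul_of_nonneg_left a2 hε.le
  have a11 : ε * q ≤ ε * Q := mul_le_mul_of_nonneg_left (by linarith) hε.le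
  rw [hs] at a10
  have a12 : (k - ε) * 1 ≤ (k - ε) * Q := mul_le_mul_of_nonneg_left a3 (by linarith)
  linarith

lemma VV_pos (ε k : ℝ) (p : Pt) : 0 < VV ε k p := Real.exp_pos _

lemma one_le_RR (p : Pt) : 1 ≤ RR p := Real.one_le_sqrt.2 (by nlinarith [sq_nonneg p.2.1, sq_nonneg p.2.2])

lemma VV_super (ε k : ℝ) (hε : 0 < ε) (hk : k = 1/2 - ε) (h5 : 5 * ε ≤ k) (p : Pt) (hp : 0 ≤ p.1) :
    4 * ε ^ 2 * VV ε k p * (br (RR p - p.1))⁻¹ * (br (RR p + p.1))⁻¹ ≤ - Box (VV ε k) p := by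
  have hR1 := one_le_RR p
  have hR := RR_pos p
  have hV := VV_pos ε k p
  have hq := br_pos (RR p - p.1)
  have hs := br_pos (RR p + p.1)
  have hq2 := br_sq (RR p - p.1)
  have hs2 := br_sq (RR p + p.1)
  have hR2 := RR_sq p
  have key := super_alg ε k _ _ (RR p) (RR p - p.1) (RR p + p.1) hε hk h5 hq hs hR1 hq2 hs2 (by ring) (by linarith)
  unfold Box
  rw [VV_pd00, VV_pd11, VV_pd22]
  have hk0 : 0 < k := by linarith
  have hx : p.2.2 ^ 2 = RR p ^ 2 - 1 - p.2.1 ^ 2 := by linarith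
  rw [hx]
  set Q := br (RR p - p.1)
  set S := br (RR p + p.1)
  have hH : 0 ≤ - HH ε k p / RR p ^ 3 := by
    simp only [HH, neg_neg]; positivity
  have hHsq : 0 ≤ HH ε k p ^ 2 / RR p ^ 2 := by positivity
  have hs3 : 0 ≤ k * (RR p + p.1) * S⁻¹ ^ 3 / RR p ^ 2 := by
    have : 0 ≤ RR p + p.1 := by linarith
    positivity
  have hmain : 0 ≤ (ε * S + k * Q - 2 * ε * RR p + ε * (RR p - p.1) * S / (Q ^ 2 * RR p)) / (Q * S * RR p) := by
    positivity
  have hid : -(-(VV ε k p * (JJ ε k p ^ 2 + JP ε k p)) +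
          VV ε k p * ((HH ε k p ^ 2 + JP ε k p) * (p.2.1 ^ 2 / RR p ^ 2) +
              HH ε k p * (1 / RR p - p.2.1 ^ 2 / RR p ^ 3)) +
        VV ε k p * ((HH ε k p ^ 2 + JP ε k p) * ((RR p ^ 2 - 1 - p.2.1 ^ 2) / RR p ^ 2) +
            HH ε k p * (1 / RR p - (RR p ^ 2 - 1 - p.2.1 ^ 2) / RR p ^ 3))) -
       4 * ε ^ 2 * VV ε k p * Q⁻¹ * S⁻¹ = VV ε k p * 
       ((ε * S + k * Q - 2 * ε * RR p + ε * (RR p - p.1) * S / (Q ^ 2 * RR p)) / (Q * S * RR p) + 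
       k * (RR p + p.1) * S⁻¹ ^ 3 / RR p ^ 2 + HH ε k p ^ 2 / RR p ^ 2 + - HH ε k p / RR p ^ 3) := by
    have e : JJ ε k p ^ 2 = HH ε k p ^ 2 - 4 * ε * k * Q⁻¹ * S⁻¹ := by
      simp only [JJ, HH]; ring
    have e2 : JP ε k p = ε * (RR p - p.1) * Q⁻¹ ^ 3 + k * (RR p + p.1) * S⁻¹ ^ 3 := rfl
    have e3 : HH ε k p = -(ε * Q⁻¹ + k * S⁻¹) := rfl
    rw [e, e2, e3, hk]
    clear_value Q S
    generalize VV ε (1/2 - ε) p = v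
    generalize RR p = R at *
    field_simp
    ring
  have : 0 ≤ VV ε k p * 
       ((ε * S + k * Q - 2 * ε * RR p + ε * (RR p - p.1) * S / (Q ^ 2 * RR p)) / (Q * S * RR p) + 
       k * (RR p + p.1) * S⁻¹ ^ 3 / RR p ^ 2 + HH ε k p ^ 2 / RR p ^ 2 + - HH ε k p / RR p ^ 3) := by
    apply mul_nonneg hV.le
    linarith
  linarith


open MeasureTheory in
lemma mono_ne (f g : ℝ → ℝ) (c : ℝ) (hf : IntervalIntegrable f volume 0 Real.pi)
    (hg : IntervalIntegrable g volume 0 Real.pi)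
    (h : ∀ x, 0 < x → x < Real.pi → x ≠ c → f x ≤ g x) :
    ∫ x in (0:ℝ)..Real.pi, f x ≤ ∫ x in (0:ℝ)..Real.pi, g x := by
  apply intervalIntegral.integral_mono_ae_restrict Real.pi_pos.le hf hg
  filter_upwards [ae_restrict_mem measurableSet_Icc, ae_restrict_of_ae (volume.ae_ne c),
    ae_restrict_of_ae (volume.ae_ne (0:ℝ)), ae_restrict_of_ae (volume.ae_ne Real.pi)] with x h1 h2 h3 h4
  exact h x (lt_of_le_of_ne h1.1 (Ne.symm h3)) (lt_of_le_of_ne h1.2 h4) h2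

lemma abs_rpow_ii (b : ℝ) (hb : b < 1) (x y : ℝ) :
    IntervalIntegrable (fun x : ℝ => |x| ^ (-b)) MeasureTheory.volume x y := by
  apply intervalIntegrable_of_even
  · intro x; simp
  · intro x hx
    refine (intervalIntegral.intervalIntegrable_rpow' (r := -b) (a := 0) (b := x) (by linarith)).congr ?_
    intro y hy
    rw [Set.uIoc_of_le hx.le] at hy
    simp only
    rw [abs_of_pos hy.1]
  · exact enorm_ne_top
  · exact enorm_ne_top

def AA (b : ℝ) : ℝ := ∫ x in (-Real.pi)..Real.pi, |x| ^ (-b)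

lemma sing_ii (b c : ℝ) (hb : b < 1) :
    IntervalIntegrable (fun x : ℝ => |x - c| ^ (-b)) MeasureTheory.volume 0 Real.pi := by
  have := (abs_rpow_ii b hb (0 - c) (Real.pi - c)).comp_sub_right c
  simpa using this

lemma sing_le (b c : ℝ) (hb : b < 1) (hc : 0 ≤ c) (hc' : c ≤ Real.pi) :
    ∫ x in (0:ℝ)..Real.pi, |x - c| ^ (-b) ≤ AA b := by
  rw [intervalIntegral.integral_comp_sub_right (fun x => |x| ^ (-b)) c]
  apply intervalIntegral.integral_mono_interval
  · linarith
  · linarith [Real.pi_pos]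
  · linarith
  · filter_upwards with x
    positivity
  · exact abs_rpow_ii b hb _ _

lemma AA_nonneg (b : ℝ) : 0 ≤ AA b :=
  intervalIntegral.integral_nonneg (by linarith [Real.pi_pos]) (fun x _ => by positivity)

lemma cos_diff (φ ψ : ℝ) (h0 : 0 ≤ ψ) (h1 : ψ ≤ φ) (h2 : φ ≤ Real.pi) :
    (|φ - ψ| / 4) ^ 2 ≤ Real.cos ψ - Real.cos φ := by
  have hpi := Real.pi_pos
  have h4 := Real.pi_le_four
  rw [Real.cos_sub_cos]
  have e1 : Real.sin ((ψ + φ) / 2) - Real.sin ((φ - ψ) / 2) = 2 * Real.sin (ψ / 2) * Real.cos (φ / 2) := by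
    rw [Real.sin_sub_sin]
    congr 2 <;> ring_nf
  have e2 : 0 ≤ Real.sin (ψ / 2) := Real.sin_nonneg_of_nonneg_of_le_pi (by linarith) (by linarith)
  have e3 : 0 ≤ Real.cos (φ / 2) := Real.cos_nonneg_of_mem_Icc ⟨by linarith, by linarith⟩
  have e4 := Real.mul_le_sin (x := (φ - ψ) / 2) (by linarith) (by linarith)
  have e5 : (φ - ψ) / 4 ≤ 2 / Real.pi * ((φ - ψ) / 2) := by
    have : 1 / 2 ≤ 2 / Real.pi := by rw [div_le_div_iff₀ (by norm_num) hpi]; linarith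
    nlinarith
  have e6 : Real.sin ((ψ - φ) / 2) = - Real.sin ((φ - ψ) / 2) := by
    rw [← Real.sin_neg]; congr 1; ring
  rw [e6, abs_of_nonneg (by linarith)]
  have e7 : (φ - ψ) / 4 ≤ Real.sin ((φ - ψ) / 2) := e5.trans e4
  have e8 : Real.sin ((φ - ψ) / 2) ≤ Real.sin ((ψ + φ) / 2) := by
    have : 0 ≤ 2 * Real.sin (ψ / 2) * Real.cos (φ / 2) := by positivity
    linarith
  have e9 : 0 ≤ (φ - ψ) / 4 := by linarith
  nlinarith

lemma cos_low (z : ℝ) (hz : 0 ≤ z) : ∃ ψ, 0 ≤ ψ ∧ ψ ≤ Real.pi ∧ ∀ φ, 0 ≤ φ → φ ≤ Real.pi →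
    (|φ - ψ| / 4) ^ 2 ≤ |z + Real.cos φ| := by
  by_cases h : z ≤ 1
  · refine ⟨Real.arccos (-z), Real.arccos_nonneg _, Real.arccos_le_pi _, fun φ h0 h1 => ?_⟩
    have hc : Real.cos (Real.arccos (-z)) = -z := Real.cos_arccos (by linarith) (by linarith)
    rcases le_total φ (Real.arccos (-z)) with h2 | h2
    · have := cos_diff _ _ h0 h2 (Real.arccos_le_pi _)
      rw [abs_sub_comm]
      refine this.trans ?_
      rw [hc]
      refine le_trans (le_of_eq ?_) (le_abs_self _)
      ring
    · have := cos_diff _ _ (Real.arccos_nonneg _) h2 h1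
      refine this.trans ?_
      rw [hc]
      refine le_trans (le_of_eq ?_) (neg_le_abs _)
      ring
  · push Not at h
    refine ⟨Real.pi, Real.pi_pos.le, le_rfl, fun φ h0 h1 => ?_⟩
    have := cos_diff _ _ h0 h1 le_rfl
    rw [abs_sub_comm]
    refine this.trans (le_trans ?_ (le_abs_self _))
    rw [Real.cos_pi]; linarith

lemma cos_low2 (θ : ℝ) (h0 : 0 ≤ θ) (h1 : θ ≤ Real.pi) : |θ - Real.pi / 2| / 2 ≤ |Real.cos θ| := by
  have hpi := Real.pi_pos
  have h4 := Real.pi_le_four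
  have e1 : |Real.cos θ| = |Real.sin (|θ - Real.pi / 2|)| := by
    rcases abs_cases (θ - Real.pi / 2) with ⟨h, _⟩ | ⟨h, _⟩
    · rw [h, Real.sin_sub_pi_div_two, abs_neg]
    · rw [h, Real.sin_neg, Real.sin_sub_pi_div_two, neg_neg]
  rw [e1]
  refine le_trans ?_ (le_abs_self _)
  have hh : |θ - Real.pi / 2| ≤ Real.pi / 2 := by rw [abs_le]; constructor <;> linarith
  refine le_trans ?_ (Real.mul_le_sin (abs_nonneg _) hh)
  have : 1 / 2 ≤ 2 / Real.pi := by rw [div_le_div_iff₀ (by norm_num) hpi]; linarith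
  have := abs_nonneg (θ - Real.pi/2)
  nlinarith

/-- pointwise bound of the boundary density -/
lemma bd_pt (ε b t0 A B d e sn : ℝ) (hε : 0 < ε) (hε1 : ε < 1) (hb : b = 1 - ε) (ht : 0 < t0)
    (hd : 0 < d) (he : 0 < e) (hs : 0 < sn) (hs1 : sn ≤ 1) (hA : t0 * (d / 4) ^ 2 ≤ |A|) 
    (hB : t0 * (sn * (e / 2)) ≤ |B|) :
    sn * (t0 * (1 + A ^ 2 + B ^ 2) ^ (-(3:ℝ)/4)) ≤ 
      8 * t0 ^ (-(1:ℝ)/2 + 3/2 * ε) * d ^ (-b) * e ^ (-b) := by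
  have hb0 : 0 < b := by linarith
  have hA0 : 0 < t0 * (d / 4) ^ 2 := by positivity
  have hB0 : 0 < t0 * (sn * (e / 2)) := by positivity
  have hD : 1 ≤ 1 + A ^ 2 + B ^ 2 := by nlinarith [sq_nonneg A, sq_nonneg B]
  have s1 : (1 + A ^ 2 + B ^ 2) ^ (-(3:ℝ)/4) ≤ 
      (1 + A ^ 2 + B ^ 2) ^ (-b/4) * (1 + A ^ 2 + B ^ 2) ^ (-b/2) := by
    rw [← Real.rpow_add (by linarith)]
    apply Real.rpow_le_rpow_of_exponent_le hD
    rw [hb]; linarith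
  have s2 : (1 + A ^ 2 + B ^ 2) ^ (-b/4) ≤ t0 ^ (-b/2) * (4 * d ^ (-b)) := by
    have : (t0 * (d/4)^2) ^ 2 ≤ 1 + A ^ 2 + B ^ 2 := by
      have : (t0 * (d/4)^2) ^ 2 ≤ |A| ^ 2 := by gcongr
      rw [sq_abs] at this
      nlinarith [sq_nonneg B]
    refine (Real.rpow_le_rpow_of_nonpos (by positivity) this (by linarith)).trans ?_
    rw [← Real.rpow_natCast, ← Real.rpow_mul (by positivity), Real.mul_rpow (by positivity) (by positivity),
      ← Real.rpow_natCast, ← Real.rpow_mul (by positivity)]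
    have e1 : ((2:ℕ):ℝ) * (-b/4) = -b/2 := by push_cast; ring
    have e2 : ((2:ℕ):ℝ) * (-b/2) = -b := by push_cast; ring
    rw [e1, e2]
    gcongr
    rw [Real.div_rpow hd.le (by norm_num), div_eq_mul_inv, mul_comm]
    gcongr
    rw [← Real.rpow_neg (by norm_num), neg_neg]
    calc (4:ℝ) ^ b ≤ 4 ^ (1:ℝ) := Real.rpow_le_rpow_of_exponent_le (by norm_num) (by linarith)
      _ = 4 := by norm_num
  have s3 : (1 + A ^ 2 + B ^ 2) ^ (-b/2) ≤ t0 ^ (-b) * (sn ^ (-b) * (2 * e ^ (-b))) := by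
    have : (t0 * (sn * (e/2))) ^ 2 ≤ 1 + A ^ 2 + B ^ 2 := by
      have : (t0 * (sn * (e/2))) ^ 2 ≤ |B| ^ 2 := by gcongr
      rw [sq_abs] at this
      nlinarith [sq_nonneg A]
    refine (Real.rpow_le_rpow_of_nonpos (by positivity) this (by linarith)).trans ?_
    rw [← Real.rpow_natCast, ← Real.rpow_mul (by positivity)]
    have e2 : ((2:ℕ):ℝ) * (-b/2) = -b := by push_cast; ring
    rw [e2, Real.mul_rpow (by positivity) (by positivity), Real.mul_rpow (by positivity) (by positivity)]
    gcongr
    rw [Real.div_rpow he.le (by norm_num), div_eq_mul_inv, mul_comm]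
    gcongr
    rw [← Real.rpow_neg (by norm_num), neg_neg]
    calc (2:ℝ) ^ b ≤ 2 ^ (1:ℝ) := Real.rpow_le_rpow_of_exponent_le (by norm_num) (by linarith)
      _ = 2 := by norm_num
  have s4 : sn * sn ^ (-b) ≤ 1 := by
    calc sn * sn ^ (-b) = sn ^ (1 + -b) := by rw [Real.rpow_add hs, Real.rpow_one]
      _ ≤ 1 := Real.rpow_le_one hs.le hs1 (by linarith)
  have s5 : t0 * (t0 ^ (-b/2) * t0 ^ (-b)) = t0 ^ (-(1:ℝ)/2 + 3/2 * ε) := by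
    rw [← Real.rpow_add ht]
    nth_rewrite 1 [← Real.rpow_one t0]
    rw [← Real.rpow_add ht]
    congr 1; rw [hb]; ring
  calc sn * (t0 * (1 + A ^ 2 + B ^ 2) ^ (-(3:ℝ)/4)) 
      ≤ sn * (t0 * ((t0 ^ (-b/2) * (4 * d ^ (-b))) * (t0 ^ (-b) * (sn ^ (-b) * (2 * e ^ (-b)))))) := by
        gcongr
        exact s1.trans (by gcongr)
    _ = (sn * sn ^ (-b)) * (8 * (t0 * (t0 ^ (-b/2) * t0 ^ (-b))) * d ^ (-b) * e ^ (-b)) := by ring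
    _ ≤ 1 * (8 * (t0 * (t0 ^ (-b/2) * t0 ^ (-b))) * d ^ (-b) * e ^ (-b)) := by
        gcongr
    _ = _ := by rw [s5]; ring


lemma bdry (ε : ℝ) (hε : 0 < ε) (hε1 : ε ≤ 1/12) : ∃ C : ℝ, 0 ≤ C ∧ ∀ t0 r0 : ℝ, 0 ≤ t0 → 0 ≤ r0 →
    ∫ φ in (0:ℝ)..Real.pi, ∫ θ in (0:ℝ)..Real.pi, Real.sin φ * (t0 * 
      (1 + (r0 + t0 * Real.cos φ) ^ 2 + (t0 * (Real.sin φ * Real.cos θ)) ^ 2) ^ (-(3:ℝ)/4)) ≤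
     C * (1 + t0) ^ (-(1:ℝ)/2 + 2 * ε) := by
  have hpi := Real.pi_pos
  have hAn := AA_nonneg (1 - ε)
  refine ⟨16 * AA (1 - ε) * AA (1 - ε) + 2 * (Real.pi * Real.pi), by positivity, fun t0 r0 ht hr => ?_⟩
  set F : ℝ → ℝ → ℝ := fun φ θ => Real.sin φ * (t0 * 
      (1 + (r0 + t0 * Real.cos φ) ^ 2 + (t0 * (Real.sin φ * Real.cos θ)) ^ 2) ^ (-(3:ℝ)/4)) with hF
  have hFc : Continuous (Function.uncurry F) := by
    have : Continuous (fun z : ℝ × ℝ => (1 + (r0 + t0 * Real.cos z.1) ^ 2 + 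
      (t0 * (Real.sin z.1 * Real.cos z.2)) ^ 2) ^ (-(3:ℝ)/4)) := by
      apply Continuous.rpow_const (by fun_prop)
      intro z; left; positivity
    exact (Continuous.mul (by fun_prop) (continuous_const.mul this))
  have hF1 : ∀ φ, IntervalIntegrable (F φ) MeasureTheory.volume 0 Real.pi := fun φ =>
    (hFc.comp (f := fun z : ℝ => (φ, z)) (by fun_prop)).intervalIntegrable _ _
  have hF2 : IntervalIntegrable (fun φ => ∫ θ in (0:ℝ)..Real.pi, F φ θ) MeasureTheory.volume 0 Real.pi :=
    (intervalIntegral.continuous_parametric_intervalIntegral_of_continuous' hFc _ _).intervalIntegrable _ _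
  have hpw : (1 + t0) ^ (-(1:ℝ)/2 + 3/2 * ε) ≤ (1 + t0) ^ (-(1:ℝ)/2 + 2 * ε) :=
    Real.rpow_le_rpow_of_exponent_le (by linarith) (by linarith)
  have hP : 0 < (1 + t0) ^ (-(1:ℝ)/2 + 2 * ε) := by positivity
  rcases le_total 1 t0 with h1 | h1
  · have ht0 : 0 < t0 := by linarith
    obtain ⟨ψ, hψ0, hψ1, hψ⟩ := cos_low (r0 / t0) (by positivity)
    set K := 8 * t0 ^ (-(1:ℝ)/2 + 3/2 * ε) with hK
    have hK0 : 0 ≤ K := by positivity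
    have inner : ∀ φ, 0 < φ → φ < Real.pi → φ ≠ ψ → 
        ∫ θ in (0:ℝ)..Real.pi, F φ θ ≤ K * AA (1 - ε) * |φ - ψ| ^ (-(1 - ε)) := by
      intro φ h0 h1 hne
      have : ∫ θ in (0:ℝ)..Real.pi, F φ θ ≤ ∫ θ in (0:ℝ)..Real.pi, 
          (K * |φ - ψ| ^ (-(1 - ε))) * |θ - Real.pi/2| ^ (-(1 - ε)) := by
        apply mono_ne _ _ (Real.pi / 2) (hF1 φ) ((sing_ii (1 - ε) _ (by linarith)).const_mul _)
        intro θ hθ0 hθ1 hθ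
        apply bd_pt ε (1 - ε) t0 _ _ _ _ _ hε (by linarith) rfl ht0 (abs_pos.2 (sub_ne_zero.2 hne))
          (abs_pos.2 (sub_ne_zero.2 hθ)) (Real.sin_pos_of_pos_of_lt_pi h0 h1) (Real.sin_le_one _)
        · have e : r0 + t0 * Real.cos φ = t0 * (r0 / t0 + Real.cos φ) := by field_simp
          rw [e, abs_mul, abs_of_pos ht0]
          exact mul_le_mul_of_nonneg_left (hψ φ h0.le h1.le) ht0.le
        · have hsn := Real.sin_pos_of_pos_of_lt_pi h0 h1
          rw [abs_mul, abs_mul, abs_of_pos ht0, abs_of_pos hsn]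
          have := cos_low2 θ hθ0.le hθ1.le
          gcongr
      refine this.trans ?_
      rw [intervalIntegral.integral_const_mul]
      have := sing_le (1 - ε) (Real.pi/2) (by linarith) (by linarith) (by linarith)
      calc _ ≤ (K * |φ - ψ| ^ (-(1 - ε))) * AA (1 - ε) := by gcongr
        _ = _ := by ring
    have outer : ∫ φ in (0:ℝ)..Real.pi, ∫ θ in (0:ℝ)..Real.pi, F φ θ ≤ 
        ∫ φ in (0:ℝ)..Real.pi, K * AA (1 - ε) * |φ - ψ| ^ (-(1 - ε)) :=
      mono_ne _ _ ψ hF2 ((sing_ii (1 - ε) _ (by linarith)).const_mul _) inner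
    rw [intervalIntegral.integral_const_mul] at outer
    have h3 := sing_le (1 - ε) ψ (by linarith) hψ0 hψ1
    have h4 : t0 ^ (-(1:ℝ)/2 + 3/2 * ε) ≤ 2 * (1 + t0) ^ (-(1:ℝ)/2 + 2 * ε) := by
      calc t0 ^ (-(1:ℝ)/2 + 3/2 * ε) ≤ ((1 + t0) / 2) ^ (-(1:ℝ)/2 + 3/2 * ε) :=
            Real.rpow_le_rpow_of_nonpos (by linarith) (by linarith) (by linarith)
        _ = (2:ℝ) ^ (-(-(1:ℝ)/2 + 3/2 * ε)) * (1 + t0) ^ (-(1:ℝ)/2 + 3/2 * ε) := by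
            rw [Real.div_rpow (by linarith) (by norm_num), Real.rpow_neg (by norm_num)]; ring
        _ ≤ 2 ^ (1:ℝ) * (1 + t0) ^ (-(1:ℝ)/2 + 2 * ε) := by
            gcongr
            · norm_num
            · linarith
        _ = _ := by rw [Real.rpow_one]
    calc _ ≤ K * AA (1 - ε) * AA (1 - ε) := outer.trans (by gcongr)
      _ ≤ (8 * (2 * (1 + t0) ^ (-(1:ℝ)/2 + 2 * ε))) * AA (1 - ε) * AA (1 - ε) := by
          rw [hK]; gcongr
      _ ≤ _ := by nlinarith [mul_pos (mul_pos hpi hpi) hP]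
  · have b1 : ∀ φ ∈ Set.Icc 0 Real.pi, ∫ θ in (0:ℝ)..Real.pi, F φ θ ≤ Real.pi := by
      intro φ hφ
      have : ∫ θ in (0:ℝ)..Real.pi, F φ θ ≤ ∫ θ in (0:ℝ)..Real.pi, (1:ℝ) := by
        apply intervalIntegral.integral_mono_on hpi.le (hF1 φ) (by simp)
        intro θ _
        have hs := Real.sin_nonneg_of_mem_Icc hφ
        have hs1 := Real.sin_le_one φ
        have hx : (1 + (r0 + t0 * Real.cos φ) ^ 2 + (t0 * (Real.sin φ * Real.cos θ)) ^ 2) ^ (-(3:ℝ)/4) ≤ 1 := 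
          Real.rpow_le_one_of_one_le_of_nonpos (by nlinarith [sq_nonneg (r0 + t0 * Real.cos φ), sq_nonneg (t0 * (Real.sin φ * Real.cos θ))]) (by norm_num)
        have hx0 : 0 ≤ (1 + (r0 + t0 * Real.cos φ) ^ 2 + (t0 * (Real.sin φ * Real.cos θ)) ^ 2) ^ (-(3:ℝ)/4) := by positivity
        exact mul_le_one₀ hs1 (by positivity) (mul_le_one₀ h1 hx0 hx)
      simpa using this
    have b2 : ∫ φ in (0:ℝ)..Real.pi, ∫ θ in (0:ℝ)..Real.pi, F φ θ ≤ ∫ φ in (0:ℝ)..Real.pi, Real.pi :=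
      intervalIntegral.integral_mono_on hpi.le hF2 (by simp) b1
    simp only [intervalIntegral.integral_const, sub_zero, smul_eq_mul] at b2
    have b3 : 1 / 2 ≤ (1 + t0) ^ (-(1:ℝ)/2 + 2 * ε) := by
      calc (1:ℝ)/2 = 2 ^ (-1:ℝ) := by rw [Real.rpow_neg_one]; norm_num
        _ ≤ (1 + t0) ^ (-1:ℝ) := Real.rpow_le_rpow_of_nonpos (by linarith) (by linarith) (by norm_num)
        _ ≤ _ := Real.rpow_le_rpow_of_exponent_le (by linarith) (by linarith)
    have b4 : 0 ≤ 16 * AA (1 - ε) * AA (1 - ε) * (1 + t0) ^ (-(1:ℝ)/2 + 2 * ε) := by positivity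
    have b5 : 0 < Real.pi * Real.pi := by positivity
    refine b2.trans ?_
    nlinarith [mul_le_mul_of_nonneg_left b3 b5.le]


lemma rad_nonneg (p : Pt) : 0 ≤ rad p := Real.sqrt_nonneg _
lemma rad_sq (p : Pt) : rad p ^ 2 = p.2.1 ^ 2 + p.2.2 ^ 2 := Real.sq_sqrt (by positivity)
lemma rad_le_RR (p : Pt) : rad p ≤ RR p := by
  have := rad_sq p; have := RR_sq p; have := RR_pos p; nlinarith
lemma RR_le_rad (p : Pt) : RR p ≤ 1 + rad p := by
  have := rad_sq p; have := RR_sq p; have := rad_nonneg p; have := RR_pos p; nlinarith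
lemma br_le (y : ℝ) : br y ≤ 1 + |y| := by
  have := br_sq y; have := br_pos y; have := abs_nonneg y; have := sq_abs y; nlinarith
lemma abs_le_br (y : ℝ) : |y| ≤ br y := by
  have := br_sq y; have := br_pos y; have := abs_nonneg y; have := sq_abs y; nlinarith
lemma exp_ars (y : ℝ) : Real.exp (Real.arsinh y) = y + br y := Real.exp_arsinh y

lemma VV_eq (ε k : ℝ) (p : Pt) : VV ε k p = (Real.exp (Real.arsinh (RR p - p.1))) ^ (-ε) *
    (Real.exp (Real.arsinh (RR p + p.1))) ^ (-k) := by
  rw [← Real.exp_mul, ← Real.exp_mul, ← Real.exp_add]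
  unfold VV
  congr 1; ring

lemma sfac (k : ℝ) (hk0 : 0 < k) (hk : k ≤ 1/2) (p : Pt) (hp : 0 ≤ p.1) :
    1/6 * (1 + svar p) ^ (-(3:ℝ)/2) ≤ (Real.exp (Real.arsinh (RR p + p.1))) ^ (-k) * (br (RR p + p.1))⁻¹ := by
  have h1 := rad_le_RR p
  have h2 := RR_le_rad p
  have h3 := rad_nonneg p
  have h4 : br (RR p + p.1) ≤ 2 * (1 + svar p) := by
    have := br_le (RR p + p.1)
    rw [abs_of_nonneg (by linarith)] at this
    unfold svar; linarith
  have hs : 0 ≤ svar p := by unfold svar; linarith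
  have h5 : Real.exp (Real.arsinh (RR p + p.1)) ≤ 3 * (1 + svar p) := by
    rw [exp_ars]; unfold svar at *; linarith
  have h6 : 1/3 * (1 + svar p) ^ (-(1:ℝ)/2) ≤ (Real.exp (Real.arsinh (RR p + p.1))) ^ (-k) := by
    calc 1/3 * (1 + svar p) ^ (-(1:ℝ)/2) = 3 ^ (-1:ℝ) * (1 + svar p) ^ (-(1:ℝ)/2) := by
          rw [Real.rpow_neg_one]; norm_num
      _ ≤ 3 ^ (-(1:ℝ)/2) * (1 + svar p) ^ (-(1:ℝ)/2) := by
          gcongr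
          · norm_num
          · norm_num
      _ = (3 * (1 + svar p)) ^ (-(1:ℝ)/2) := by rw [Real.mul_rpow (by norm_num) (by linarith)]
      _ ≤ (3 * (1 + svar p)) ^ (-k) := Real.rpow_le_rpow_of_exponent_le (by linarith) (by linarith)
      _ ≤ _ := Real.rpow_le_rpow_of_nonpos (Real.exp_pos _) h5 (by linarith)
  have h7 : 1/2 * (1 + svar p) ^ (-1:ℝ) ≤ (br (RR p + p.1))⁻¹ := by
    calc 1/2 * (1 + svar p) ^ (-1:ℝ) = (2 * (1 + svar p))⁻¹ := by
          rw [Real.rpow_neg_one, mul_inv]; norm_num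
      _ ≤ _ := inv_anti₀ (br_pos _) h4
  calc 1/6 * (1 + svar p) ^ (-(3:ℝ)/2) = (1/3 * (1 + svar p) ^ (-(1:ℝ)/2)) * (1/2 * (1 + svar p) ^ (-1:ℝ)) := by
        have : (1 + svar p) ^ (-(3:ℝ)/2) = (1 + svar p) ^ (-(1:ℝ)/2) * (1 + svar p) ^ (-1:ℝ) := by
          rw [← Real.rpow_add (by linarith)]; norm_num
        rw [this]; ring
    _ ≤ _ := by gcongr

lemma brq (p : Pt) : 1/2 * (1 + |qvar p|)⁻¹ ≤ (br (RR p - p.1))⁻¹ := by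
  have h1 := rad_le_RR p
  have h2 := RR_le_rad p
  have h4 : br (RR p - p.1) ≤ 2 * (1 + |qvar p|) := by
    have := br_le (RR p - p.1)
    have h : |RR p - p.1| ≤ |qvar p| + 1 := by
      have : RR p - p.1 = qvar p + (RR p - rad p) := by unfold qvar; ring
      rw [this]
      refine (abs_add_le _ _).trans ?_
      have : |RR p - rad p| ≤ 1 := by rw [abs_le]; constructor <;> linarith
      linarith
    have := abs_nonneg (qvar p)
    linarith
  calc 1/2 * (1 + |qvar p|)⁻¹ = (2 * (1 + |qvar p|))⁻¹ := by rw [mul_inv]; norm_num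
      _ ≤ _ := inv_anti₀ (br_pos _) h4

lemma src_of (ε k : ℝ) (hε : 0 < ε) (hk : k = 1/2 - ε) (h5 : 5 * ε ≤ k) (p : Pt) (hp : 0 ≤ p.1) (m : ℝ)
    (hm0 : 0 ≤ m)
    (hm : 1/3 * m ≤ (Real.exp (Real.arsinh (RR p - p.1))) ^ (-ε)) :
    ε ^ 2 / 9 * ((1 + svar p) ^ (-(3:ℝ)/2) * ((1 + |qvar p|)⁻¹ * m)) ≤ - Box (VV ε k) p := by
  refine le_trans ?_ (VV_super ε k hε hk h5 p hp)
  rw [VV_eq]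
  have a1 := sfac k (by linarith) (by linarith) p hp
  have a2 := brq p
  have hs : 0 ≤ svar p := by have := rad_nonneg p; unfold svar; linarith
  have hb := br_pos (RR p - p.1)
  have hb2 := br_pos (RR p + p.1)
  calc _ = 4 * ε ^ 2 * ((1/3 * m) * (1/6 * (1 + svar p) ^ (-(3:ℝ)/2)) * (1/2 * (1 + |qvar p|)⁻¹)) := by ring
    _ ≤ 4 * ε ^ 2 * ((Real.exp (Real.arsinh (RR p - p.1))) ^ (-ε) * 
        ((Real.exp (Real.arsinh (RR p + p.1))) ^ (-k) * (br (RR p + p.1))⁻¹) * (br (RR p - p.1))⁻¹) := by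
        gcongr
    _ = _ := by ring

lemma src_neg (ε k : ℝ) (hε : 0 < ε) (hk : k = 1/2 - ε) (h5 : 5 * ε ≤ k) (p : Pt) (hp : 0 ≤ p.1)
    (hq : qvar p < 0) :
    ε ^ 2 / 9 * ((1 + svar p) ^ (-(3:ℝ)/2) * ((1 + |qvar p|)⁻¹)) ≤ - Box (VV ε k) p := by
  have := src_of ε k hε hk h5 p hp 1 (by norm_num) (by
    have h2 := RR_le_rad p
    have hb : RR p - p.1 ≤ 1 := by unfold qvar at hq; linarith
    have : Real.exp (Real.arsinh (RR p - p.1)) ≤ 3 := by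
      calc Real.exp (Real.arsinh (RR p - p.1)) ≤ Real.exp (Real.arsinh 1) :=
            Real.exp_le_exp.2 (Real.arsinh_le_arsinh.2 hb)
        _ = 1 + br 1 := exp_ars 1
        _ ≤ 3 := by have := br_le 1; norm_num at this; linarith
    calc 1/3 * (1:ℝ) = 3 ^ (-1:ℝ) := by rw [Real.rpow_neg_one]; norm_num
      _ ≤ 3 ^ (-ε) := Real.rpow_le_rpow_of_exponent_le (by norm_num) (by linarith)
      _ ≤ _ := Real.rpow_le_rpow_of_nonpos (Real.exp_pos _) this (by linarith))
  simpa using this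

lemma src_pos (ε k : ℝ) (hε : 0 < ε) (hk : k = 1/2 - ε) (h5 : 5 * ε ≤ k) (p : Pt) (hp : 0 ≤ p.1)
    (hq : 0 ≤ qvar p) :
    ε ^ 2 / 9 * ((1 + svar p) ^ (-(3:ℝ)/2) * ((1 + |qvar p|) ^ (-1 - ε))) ≤ - Box (VV ε k) p := by
  have hpos : 0 < 1 + |qvar p| := by positivity
  have e : (1 + |qvar p|) ^ (-1 - ε) = (1 + |qvar p|)⁻¹ * (1 + |qvar p|) ^ (-ε) := by
    rw [← Real.rpow_neg_one, ← Real.rpow_add hpos]; congr 1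
  rw [e]
  apply src_of ε k hε hk h5 p hp _ (by positivity)
  have h2 := RR_le_rad p
  have h1 := rad_le_RR p
  have : Real.exp (Real.arsinh (RR p - p.1)) ≤ 3 * (1 + |qvar p|) := by
    rw [exp_ars, abs_of_nonneg hq]
    have := br_le (RR p - p.1)
    unfold qvar at *
    rw [abs_of_nonneg (by linarith)] at this
    linarith
  calc 1/3 * (1 + |qvar p|) ^ (-ε) = 3 ^ (-1:ℝ) * (1 + |qvar p|) ^ (-ε) := by
        rw [Real.rpow_neg_one]; norm_num
    _ ≤ 3 ^ (-ε) * (1 + |qvar p|) ^ (-ε) := by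
        gcongr
        · norm_num
        · linarith
    _ = (3 * (1 + |qvar p|)) ^ (-ε) := by rw [Real.mul_rpow (by norm_num) (by linarith)]
    _ ≤ _ := Real.rpow_le_rpow_of_nonpos (Real.exp_pos _) this (by linarith)

lemma VV_upper (ε k : ℝ) (hε : 0 < ε) (hk : k = 1/2 - ε) (h5 : 5 * ε ≤ k) (p : Pt) (hp : 0 ≤ p.1) :
    VV ε k p ≤ 2 * (1 + p.1) ^ (-(1:ℝ)/2 + 2 * ε) := by
  rw [VV_eq]
  have hR := one_le_RR p
  have a1 : (Real.exp (Real.arsinh (RR p + p.1))) ^ (-k) ≤ (1 + p.1) ^ (-k) := by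
    apply Real.rpow_le_rpow_of_nonpos (by linarith) _ (by linarith)
    rw [exp_ars]; have := br_pos (RR p + p.1); linarith
  have a2 : (Real.exp (Real.arsinh (RR p - p.1))) ^ (-ε) ≤ 2 * (1 + p.1) ^ ε := by
    rw [Real.rpow_neg (Real.exp_pos _).le, ← Real.inv_rpow (Real.exp_pos _).le, ← Real.exp_neg, ← Real.arsinh_neg]
    have : Real.exp (Real.arsinh (-(RR p - p.1))) ≤ 2 * (1 + p.1) := by
      rw [exp_ars]
      have := br_le (-(RR p - p.1))
      rcases abs_cases (-(RR p - p.1)) with ⟨h, _⟩ | ⟨h, _⟩ <;> rw [h] at this <;> linarith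
    calc _ ≤ (2 * (1 + p.1)) ^ ε := Real.rpow_le_rpow (Real.exp_pos _).le this hε.le
      _ = 2 ^ ε * (1 + p.1) ^ ε := Real.mul_rpow (by norm_num) (by linarith)
      _ ≤ 2 ^ (1:ℝ) * (1 + p.1) ^ ε := by
          gcongr
          · norm_num
          · linarith
      _ = _ := by rw [Real.rpow_one]
  calc _ ≤ (2 * (1 + p.1) ^ ε) * (1 + p.1) ^ (-k) := by gcongr
    _ = 2 * (1 + p.1) ^ (-(1:ℝ)/2 + 2 * ε) := by
      rw [mul_assoc, ← Real.rpow_add (by linarith)]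
      congr 2; rw [hk]; ring

/-- lower bound of the boundary density of `VV` at `t = 0` -/
lemma VV_bd (ε k : ℝ) (hε : 0 < ε) (hk : k = 1/2 - ε) (h5 : 5 * ε ≤ k) (y1 y2 o1 o2 t0 : ℝ) (ht : 0 ≤ t0)
    (ho : o1 ^ 2 + o2 ^ 2 ≤ 1) :
    -(t0 * (1 + y1 ^ 2 + y2 ^ 2) ^ (-(3:ℝ)/4)) ≤
      VV ε k (0, y1, y2) + t0 * fderiv ℝ (VV ε k) (0, y1, y2) (1, o1, o2) := by
  set p : Pt := (0, y1, y2) with hp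
  have e1 : fderiv ℝ (VV ε k) p (1, o1, o2) = VV ε k p * (JJ ε k p + HH ε k p * ((y1 * o1 + y2 * o2) / RR p)) := by
    rw [clm_expand]
    have h0 := congrFun (VV_pd0 ε k) p
    have h1 := congrFun (VV_pd1 ε k) p
    have h2 := congrFun (VV_pd2 ε k) p
    unfold pd at h0 h1 h2
    rw [h0, h1, h2]
    simp only [hp, smul_eq_mul]
    ring
  have hR1 := one_le_RR p
  have hR := RR_pos p
  have hR2 := RR_sq p
  have hV := VV_pos ε k p
  have hb := br_pos (RR p)
  have hbR : RR p ≤ br (RR p) := (le_abs_self _).trans (abs_le_br _)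
  have hc : (y1 * o1 + y2 * o2) / RR p ≤ 1 := by
    rw [div_le_one hR]
    have : (y1 * o1 + y2 * o2) ^ 2 ≤ RR p ^ 2 := by
      rw [hR2]
      simp only [hp]
      nlinarith [sq_nonneg (y1 * o2 - y2 * o1), mul_nonneg (sub_nonneg.2 ho) (add_nonneg (sq_nonneg y1) (sq_nonneg y2))]
    exact (abs_le_of_sq_le_sq' this hR.le).2
  have hJ : JJ ε k p = (ε - k) * (br (RR p))⁻¹ := by simp [JJ, hp]; ring
  have hH : HH ε k p = -(1/2) * (br (RR p))⁻¹ := by simp [HH, hp, hk]; ring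
  have hlow : -(br (RR p))⁻¹ ≤ JJ ε k p + HH ε k p * ((y1 * o1 + y2 * o2) / RR p) := by
    rw [hJ, hH]
    have hi : 0 < (br (RR p))⁻¹ := by positivity
    have : 0 ≤ (br (RR p))⁻¹ * (1 + (ε - k) - 1/2 * ((y1 * o1 + y2 * o2) / RR p)) := by
      apply mul_nonneg hi.le
      rw [hk]; linarith
    linarith
  have hi : (br (RR p))⁻¹ ≤ (RR p) ^ (-1:ℝ) := by
    rw [Real.rpow_neg_one]; exact inv_anti₀ hR hbR
  have hVu : VV ε k p ≤ (RR p) ^ (-(1:ℝ)/2) := by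
    rw [VV_eq]
    have : (0:ℝ) = p.1 := rfl
    rw [← this, sub_zero, add_zero, ← Real.rpow_add (Real.exp_pos _)]
    have : -ε + -k = -(1:ℝ)/2 := by rw [hk]; ring
    rw [this]
    apply Real.rpow_le_rpow_of_nonpos hR _ (by norm_num)
    rw [exp_ars]; linarith
  have hRe : (1 + y1 ^ 2 + y2 ^ 2) ^ (-(3:ℝ)/4) = (RR p) ^ (-(1:ℝ)/2) * (RR p) ^ (-1:ℝ) := by
    have : 1 + y1 ^ 2 + y2 ^ 2 = RR p ^ 2 := by rw [hR2]
    rw [this, ← Real.rpow_natCast, ← Real.rpow_mul hR.le, ← Real.rpow_add hR]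
    norm_num
  rw [e1, hRe]
  have m1 : VV ε k p * (br (RR p))⁻¹ ≤ (RR p) ^ (-(1:ℝ)/2) * (RR p) ^ (-1:ℝ) := by gcongr
  have m2 := mul_le_mul_of_nonneg_left hlow hV.le
  have m3 := mul_le_mul_of_nonneg_left m2 ht
  have m4 := mul_le_mul_of_nonneg_left m1 ht
  nlinarith


lemma pd_lin (g h : Pt → ℝ) (hg : Differentiable ℝ g) (hh : Differentiable ℝ h) (a b : ℝ) (v : Pt) :
    pd v (fun p => a * g p + b * h p) = fun p => a * pd v g p + b * pd v h p := by
  funext p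
  unfold pd
  have := (((hg p).hasFDerivAt.const_mul a).add ((hh p).hasFDerivAt.const_mul b)).fderiv
  have e : (fun p => a * g p + b * h p) = (fun p => a * g p) + (fun p => b * h p) := rfl
  rw [e, this]
  simp

lemma pd_diff (g : Pt → ℝ) (hg : ContDiff ℝ 2 g) (v : Pt) : Differentiable ℝ (pd v g) := by
  have h1 : ContDiff ℝ 1 (fderiv ℝ g) := hg.fderiv_right (by norm_num)
  have : ContDiff ℝ 1 (pd v g) := h1.clm_apply contDiff_const
  exact this.differentiable (by norm_num)

lemma Box_lin (g h : Pt → ℝ) (hg : ContDiff ℝ 2 g) (hh : ContDiff ℝ 2 h) (a b : ℝ) (p : Pt) :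
    Box (fun p => a * g p + b * h p) p = a * Box g p + b * Box h p := by
  have dg := hg.differentiable (by norm_num)
  have dh := hh.differentiable (by norm_num)
  unfold Box
  rw [pd_lin g h dg dh, pd_lin g h dg dh, pd_lin g h dg dh,
    pd_lin _ _ (pd_diff g hg e0) (pd_diff h hh e0), pd_lin _ _ (pd_diff g hg e1) (pd_diff h hh e1),
    pd_lin _ _ (pd_diff g hg e2) (pd_diff h hh e2)]
  ring

lemma Box_cont (g : Pt → ℝ) (hg : ContDiff ℝ 2 g) : Continuous (Box g) := by
  have h1 : ContDiff ℝ 1 (fderiv ℝ g) := hg.fderiv_right (by norm_num)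
  have hc : Continuous (fderiv ℝ (fderiv ℝ g)) := h1.continuous_fderiv (by norm_num)
  have h2 : ∀ v, Continuous (pd v (pd v g)) := by
    intro v
    have : pd v (pd v g) = fun p => fderiv ℝ (fderiv ℝ g) p v v := by
      funext p; exact pd_pd g hg v v p
    rw [this]
    exact (hc.clm_apply continuous_const).clm_apply continuous_const
  exact (((h2 e0).neg.add (h2 e1)).add (h2 e2))

lemma data0 (u : Pt → ℝ) (hu : ContDiff ℝ 2 u) (hd0 : ∀ x : ℝ × ℝ, u (0, x.1, x.2) = 0)
    (hd1 : ∀ x : ℝ × ℝ, pd e0 u (0, x.1, x.2) = 0) (y1 y2 : ℝ) (v : Pt) :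
    fderiv ℝ u (0, y1, y2) v = 0 := by
  have du := hu.differentiable (by norm_num)
  have h0 : fderiv ℝ u (0, y1, y2) e0 = 0 := hd1 (y1, y2)
  have h1 : fderiv ℝ u (0, y1, y2) e1 = 0 := by
    apply pd1_slice u (0, y1, y2) 0 (du _)
    have : (fun z => u (0, z, y2)) = fun _ => 0 := by funext z; exact hd0 (z, y2)
    simp only
    rw [this]; exact hasDerivAt_const _ _
  have h2 : fderiv ℝ u (0, y1, y2) e2 = 0 := by
    apply pd2_slice u (0, y1, y2) 0 (du _)
    have : (fun z => u (0, y1, z)) = fun _ => 0 := by funext z; exact hd0 (y1, z)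
    simp only
    rw [this]; exact hasDerivAt_const _ _
  obtain ⟨a, b, c⟩ := v
  rw [clm_expand, h0, h1, h2]; simp

lemma compare_u (u V : Pt → ℝ) (hu : ContDiff ℝ 2 u) (hV : ContDiff ℝ 2 V)
    (hd0 : ∀ x : ℝ × ℝ, u (0, x.1, x.2) = 0)
    (hd1 : ∀ x : ℝ × ℝ, pd e0 u (0, x.1, x.2) = 0)
    (t0 x1 x2 a1 a2 A B : ℝ) (ht0 : 0 ≤ t0) (ha : a1 ^ 2 + a2 ^ 2 = 1) (hA : 0 ≤ A)
    (hbox : ∀ p : Pt, 0 ≤ p.1 → p.1 ≤ t0 →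
      (p.2.1 - x1) ^ 2 + (p.2.2 - x2) ^ 2 ≤ (t0 - p.1) ^ 2 → |Box u p| ≤ A * (-Box V p))
    (hB : -B ≤ ∫ φ in (0:ℝ)..Real.pi, ∫ θ in (0:ℝ)..Real.pi, Real.sin φ * 
      (V (X t0 x1 x2 a1 a2 t0 φ θ) + 
        t0 * fderiv ℝ V (X t0 x1 x2 a1 a2 t0 φ θ) (om a1 a2 φ θ 1))) :
    2 * Real.pi * |u (t0, x1, x2)| ≤ A * (2 * Real.pi * V (t0, x1, x2) + B) := by
  have dV := hV.differentiable (by norm_num)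
  have du := hu.differentiable (by norm_num)
  have key : ∀ σ : ℝ, (σ = 1 ∨ σ = -1) → 
      A * (-B) ≤ 2 * Real.pi * (A * V (t0, x1, x2) + σ * u (t0, x1, x2)) := by
    intro σ hσ
    have h := comparison (fun p => A * V p + σ * u p) 
      ((contDiff_const.mul hV).add (contDiff_const.mul hu)) t0 x1 x2 a1 a2 ht0 ha (by
        intro p h1 h2 h3
        rw [Box_lin V u hV hu]
        have := abs_le.1 (hbox p h1 h2 h3)
        rcases hσ with rfl | rfl <;> linarith)
    refine le_trans (le_trans (mul_le_mul_of_nonneg_left hB hA) (le_of_eq ?_)) h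
    rw [← intervalIntegral.integral_const_mul]
    congr 1; funext φ
    rw [← intervalIntegral.integral_const_mul]
    congr 1; funext θ
    have e := congrFun (pd_lin V u dV du A σ (om a1 a2 φ θ 1)) (X t0 x1 x2 a1 a2 t0 φ θ)
    unfold pd at e
    rw [e]
    have hX : ∃ y1 y2, X t0 x1 x2 a1 a2 t0 φ θ = (0, y1, y2) := ⟨_, _, by
      unfold X; rw [sub_self]⟩
    obtain ⟨y1, y2, hy⟩ := hX
    rw [hy, data0 u hu hd0 hd1, hd0 (y1, y2)]
    ring
  have k1 := key 1 (Or.inl rfl)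
  have k2 := key (-1) (Or.inr rfl)
  have hpi := Real.pi_pos
  rcases abs_cases (u (t0, x1, x2)) with ⟨h, _⟩ | ⟨h, _⟩ <;> rw [h] <;> linarith

lemma rad_tri (p : Pt) (x1 x2 d : ℝ) (hd : 0 ≤ d) (h : (p.2.1 - x1) ^ 2 + (p.2.2 - x2) ^ 2 ≤ d ^ 2) (t : ℝ) :
    rad p ≤ rad (t, x1, x2) + d ∧ rad (t, x1, x2) ≤ rad p + d := by
  have e : ∀ a b : ℝ, Real.sqrt (a ^ 2 + b ^ 2) = ‖(⟨a, b⟩ : ℂ)‖ := by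
    intro a b
    rw [Complex.norm_eq_sqrt_sq_add_sq]
  have hd' : ‖(⟨p.2.1, p.2.2⟩ : ℂ) - ⟨x1, x2⟩‖ ≤ d := by
    have : (⟨p.2.1, p.2.2⟩ : ℂ) - ⟨x1, x2⟩ = ⟨p.2.1 - x1, p.2.2 - x2⟩ := rfl
    rw [this, ← e]
    exact Real.sqrt_le_iff.2 ⟨hd, h⟩
  unfold rad
  simp only [e]
  constructor
  · have := norm_sub_norm_le (⟨p.2.1, p.2.2⟩ : ℂ) ⟨x1, x2⟩
    linarith
  · have := norm_sub_norm_le (⟨x1, x2⟩ : ℂ) ⟨p.2.1, p.2.2⟩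
    rw [norm_sub_rev] at this
    linarith

lemma rad_cont : Continuous rad := by unfold rad; fun_prop

open Filter Topology in
lemma ext0 (f : Pt → ℝ) (hf : Continuous f) (C0 m n : ℝ)
    (hfpos : ∀ p : Pt, 0 ≤ p.1 → 0 < qvar p →
      |f p| ≤ C0 * (1 + svar p) ^ m * (1 + |qvar p|) ^ n) (p : Pt) (hp : 0 ≤ p.1) (hq : 0 ≤ qvar p) :
      |f p| ≤ C0 * (1 + svar p) ^ m * (1 + |qvar p|) ^ n := by
  obtain ⟨σ, hσ⟩ : ∃ σ : ℝ, (σ = 1 ∨ σ = -1) ∧ 0 ≤ σ * p.2.1 := by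
    rcases le_total 0 p.2.1 with h | h
    · exact ⟨1, Or.inl rfl, by linarith⟩
    · exact ⟨-1, Or.inr rfl, by linarith⟩
  set c : ℝ → Pt := fun h => (p.1, p.2.1 + σ * h, p.2.2) with hc
  have hcc : Continuous c := by simp only [hc]; fun_prop
  have c0 : c 0 = p := by simp [hc]
  have hs0 : 0 ≤ svar p := add_nonneg hp (rad_nonneg p)
  have hsc : Continuous svar := continuous_fst.add rad_cont
  have hqc : Continuous qvar := rad_cont.sub continuous_fst
  have T1 : Tendsto (fun h => |f (c h)|) (𝓝[>] 0) (𝓝 |f p|) := by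
    have : Continuous (fun h => |f (c h)|) := (hf.comp hcc).abs
    have := (this.tendsto 0).mono_left (nhdsWithin_le_nhds (s := Set.Ioi 0))
    rwa [c0] at this
  have T2 : Tendsto (fun h => C0 * (1 + svar (c h)) ^ m * (1 + |qvar (c h)|) ^ n) (𝓝[>] 0) 
      (𝓝 (C0 * (1 + svar p) ^ m * (1 + |qvar p|) ^ n)) := by
    have : ContinuousAt (fun h => C0 * (1 + svar (c h)) ^ m * (1 + |qvar (c h)|) ^ n) 0 := by
      apply ContinuousAt.mul
      · apply continuousAt_const.mul
        apply ContinuousAt.rpow_const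
        · exact (continuous_const.add (hsc.comp hcc)).continuousAt
        · left; rw [c0]; positivity
      · apply ContinuousAt.rpow_const
        · exact (continuous_const.add (hqc.comp hcc).abs).continuousAt
        · left; rw [c0]; positivity
    have := this.tendsto.mono_left (nhdsWithin_le_nhds (s := Set.Ioi 0))
    rwa [c0] at this
  refine le_of_tendsto_of_tendsto T1 T2 ?_
  filter_upwards [self_mem_nhdsWithin] with h hh
  apply hfpos (c h) hp
  have hh : 0 < h := hh
  have hlt : rad p < rad (c h) := by
    unfold rad
    apply Real.sqrt_lt_sqrt (by positivity)
    simp only [hc]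
    have : σ ^ 2 = 1 := by rcases hσ.1 with h | h <;> rw [h] <;> norm_num
    nlinarith [mul_nonneg hσ.2 hh.le, mul_pos hh hh]
  have : (c h).1 = p.1 := rfl
  unfold qvar at *
  rw [this]; linarith


lemma Box_sq (p : Pt) : Box (fun p : Pt => p.1 ^ 2 / 2) p = -1 := by
  have hg : ContDiff ℝ 2 (fun p : Pt => p.1 ^ 2 / 2) := by fun_prop
  have dg := hg.differentiable (by norm_num)
  have h0 : pd e0 (fun p : Pt => p.1 ^ 2 / 2) = fun p => p.1 := by
    funext p
    apply pd0_slice _ _ _ (dg p)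
    exact (((hasDerivAt_id p.1).pow 2).div_const 2).congr_deriv (by simp)
  have h1 : pd e1 (fun p : Pt => p.1 ^ 2 / 2) = fun p => 0 := by
    funext p
    apply pd1_slice _ _ _ (dg p)
    exact hasDerivAt_const p.2.1 (p.1 ^ 2 / 2)
  have h2 : pd e2 (fun p : Pt => p.1 ^ 2 / 2) = fun p => 0 := by
    funext p
    apply pd2_slice _ _ _ (dg p)
    exact hasDerivAt_const p.2.2 (p.1 ^ 2 / 2)
  unfold Box
  rw [h0, h1, h2]
  have h00 : pd e0 (fun p : Pt => p.1) p = 1 := by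
    apply pd0_slice _ _ _ (by fun_prop)
    exact hasDerivAt_id _
  rw [h00]
  simp [pd]

lemma frame (x1 x2 : ℝ) : ∃ a1 a2 : ℝ, a1 ^ 2 + a2 ^ 2 = 1 ∧
    x1 = Real.sqrt (x1 ^ 2 + x2 ^ 2) * a1 ∧ x2 = Real.sqrt (x1 ^ 2 + x2 ^ 2) * a2 := by
  by_cases h : Real.sqrt (x1 ^ 2 + x2 ^ 2) = 0
  · refine ⟨1, 0, by norm_num, ?_, ?_⟩
    · rw [Real.sqrt_eq_zero (by positivity)] at h
      have : x1 ^ 2 = 0 := by nlinarith [sq_nonneg x1, sq_nonneg x2]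
      rw [h, Real.sqrt_zero, zero_mul]; exact pow_eq_zero_iff (by norm_num) |>.1 this
    · rw [Real.sqrt_eq_zero (by positivity)] at h
      have : x2 ^ 2 = 0 := by nlinarith [sq_nonneg x1, sq_nonneg x2]
      rw [mul_zero]; exact pow_eq_zero_iff (by norm_num) |>.1 this
  · have e : Real.sqrt (x1 ^ 2 + x2 ^ 2) ^ 2 = x1 ^ 2 + x2 ^ 2 := Real.sq_sqrt (by positivity)
    refine ⟨x1 / Real.sqrt (x1 ^ 2 + x2 ^ 2), x2 / Real.sqrt (x1 ^ 2 + x2 ^ 2), ?_, ?_, ?_⟩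
    · have hne : x1 ^ 2 + x2 ^ 2 ≠ 0 := fun h' => h (by rw [h', Real.sqrt_zero])
      rw [div_pow, div_pow, ← add_div, e, div_self hne]
    · field_simp
    · field_simp

/-- boundary integral of `VV` -/
lemma VV_bdint (ε k : ℝ) (hε : 0 < ε) (hk : k = 1/2 - ε) (h5 : 5 * ε ≤ k) (t0 r0 a1 a2 B : ℝ) (ht : 0 ≤ t0)
    (ha : a1 ^ 2 + a2 ^ 2 = 1) 
    (hB : ∫ φ in (0:ℝ)..Real.pi, ∫ θ in (0:ℝ)..Real.pi, Real.sin φ * (t0 * 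
      (1 + (r0 + t0 * Real.cos φ) ^ 2 + (t0 * (Real.sin φ * Real.cos θ)) ^ 2) ^ (-(3:ℝ)/4)) ≤ B) :
    -B ≤ ∫ φ in (0:ℝ)..Real.pi, ∫ θ in (0:ℝ)..Real.pi, Real.sin φ * 
      (VV ε k (X t0 (r0 * a1) (r0 * a2) a1 a2 t0 φ θ) + 
        t0 * fderiv ℝ (VV ε k) (X t0 (r0 * a1) (r0 * a2) a1 a2 t0 φ θ) (om a1 a2 φ θ 1)) := by
  have hpi := Real.pi_pos
  refine (neg_le_neg hB).trans ?_
  rw [← intervalIntegral.integral_neg]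
  simp only [← intervalIntegral.integral_neg]
  set F : ℝ → ℝ → ℝ := fun φ θ => -(Real.sin φ * (t0 * 
      (1 + (r0 + t0 * Real.cos φ) ^ 2 + (t0 * (Real.sin φ * Real.cos θ)) ^ 2) ^ (-(3:ℝ)/4))) with hF
  set G : ℝ → ℝ → ℝ := fun φ θ => Real.sin φ * 
      (VV ε k (X t0 (r0 * a1) (r0 * a2) a1 a2 t0 φ θ) + 
        t0 * fderiv ℝ (VV ε k) (X t0 (r0 * a1) (r0 * a2) a1 a2 t0 φ θ) (om a1 a2 φ θ 1)) with hG
  have hFc : Continuous (Function.uncurry F) := by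
    have : Continuous (fun z : ℝ × ℝ => (1 + (r0 + t0 * Real.cos z.1) ^ 2 + 
      (t0 * (Real.sin z.1 * Real.cos z.2)) ^ 2) ^ (-(3:ℝ)/4)) := by
      apply Continuous.rpow_const (by fun_prop)
      intro z; left; positivity
    exact (Continuous.mul (by fun_prop) (continuous_const.mul this)).neg
  have hGc : Continuous (Function.uncurry G) := by
    have hX : Continuous (fun z : ℝ × ℝ => X t0 (r0 * a1) (r0 * a2) a1 a2 t0 z.1 z.2) := by
      unfold X; fun_prop
    have ho : Continuous (fun z : ℝ × ℝ => om a1 a2 z.1 z.2 1) := by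
      unfold om; fun_prop
    have c1 := (VV_contDiff ε k).continuous.comp hX
    have c2 := ((VV_contDiff ε k).continuous_fderiv (by norm_num)).comp hX
    exact Continuous.mul (by fun_prop) (c1.add (continuous_const.mul (c2.clm_apply ho)))
  have s1 : ∀ f : ℝ → ℝ → ℝ, Continuous (Function.uncurry f) → ∀ φ, 
      IntervalIntegrable (f φ) MeasureTheory.volume 0 Real.pi := fun f hf φ =>
    (hf.comp (f := fun z : ℝ => (φ, z)) (by fun_prop)).intervalIntegrable _ _
  have s2 : ∀ f : ℝ → ℝ → ℝ, Continuous (Function.uncurry f) → 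
      IntervalIntegrable (fun φ => ∫ θ in (0:ℝ)..Real.pi, f φ θ) MeasureTheory.volume 0 Real.pi := fun f hf =>
    (intervalIntegral.continuous_parametric_intervalIntegral_of_continuous' hf _ _).intervalIntegrable _ _
  apply intervalIntegral.integral_mono_on hpi.le (s2 F hFc) (s2 G hGc)
  intro φ hφ
  apply intervalIntegral.integral_mono_on hpi.le (s1 F hFc φ) (s1 G hGc φ)
  intro θ hθ
  simp only [hF, hG]
  rw [← mul_neg]
  apply mul_le_mul_of_nonneg_left _ (Real.sin_nonneg_of_mem_Icc hφ)
  have e1' := Real.sin_sq_add_cos_sq φ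
  have e2' := Real.sin_sq_add_cos_sq θ
  have ho : (Real.cos φ * a1 - Real.sin φ * Real.cos θ * a2) ^ 2 + 
      (Real.cos φ * a2 + Real.sin φ * Real.cos θ * a1) ^ 2 ≤ 1 := by
    have e : (Real.cos φ * a1 - Real.sin φ * Real.cos θ * a2) ^ 2 + 
      (Real.cos φ * a2 + Real.sin φ * Real.cos θ * a1) ^ 2 = 
      (Real.cos φ ^ 2 + Real.sin φ ^ 2 * Real.cos θ ^ 2) * (a1 ^ 2 + a2 ^ 2) := by ring
    rw [e, ha]
    nlinarith [mul_nonneg (sq_nonneg (Real.sin φ)) (sq_nonneg (Real.sin θ))]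
  have h := VV_bd ε k hε hk h5 (r0 * a1 + t0 * (Real.cos φ * a1 - Real.sin φ * Real.cos θ * a2))
    (r0 * a2 + t0 * (Real.cos φ * a2 + Real.sin φ * Real.cos θ * a1)) _ _ t0 ht ho
  have e : 1 + (r0 * a1 + t0 * (Real.cos φ * a1 - Real.sin φ * Real.cos θ * a2)) ^ 2 + 
    (r0 * a2 + t0 * (Real.cos φ * a2 + Real.sin φ * Real.cos θ * a1)) ^ 2 = 
    1 + (r0 + t0 * Real.cos φ) ^ 2 + (t0 * (Real.sin φ * Real.cos θ)) ^ 2 := by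
    linear_combination ((r0 + t0 * Real.cos φ) ^ 2 + (t0 * (Real.sin φ * Real.cos θ)) ^ 2) * ha
  rw [e] at h
  unfold X om
  rw [sub_self]
  exact h

lemma third (a b : ℝ) (ha : 1 ≤ a) (hb : 1 ≤ b) (h : b ≤ 3 * a) :
    a ^ (-(1:ℝ)/2) ≤ 3 * b ^ (-(1:ℝ)/2) := by
  calc a ^ (-(1:ℝ)/2) ≤ (b / 3) ^ (-(1:ℝ)/2) :=
        Real.rpow_le_rpow_of_nonpos (by linarith) (by linarith) (by norm_num)
    _ = 3 ^ ((1:ℝ)/2) * b ^ (-(1:ℝ)/2) := by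
        rw [Real.div_rpow (by linarith) (by norm_num)]
        have : (3:ℝ) ^ (-(1:ℝ)/2) = (3 ^ ((1:ℝ)/2))⁻¹ := by
          rw [← Real.rpow_neg (by norm_num)]; norm_num
        rw [this, div_inv_eq_mul, mul_comm]
    _ ≤ 3 ^ (1:ℝ) * b ^ (-(1:ℝ)/2) := by
        gcongr
        · norm_num
        · norm_num
    _ = _ := by rw [Real.rpow_one]


/-- **Corollary of the L∞–L∞ estimate (Lemma `linf2`).**
Let `ρ > 0`, `0 ≤ α ≤ β`, `β − α ≥ ρ`. If `□u = f` with zero data and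
`|f| ≲ (1+s)^{−3/2+α}(1+|q|)^{−1}` for `q < 0`,
`|f| ≲ (1+s)^{−3/2+α}(1+|q|)^{−1−β}` for `q > 0`, then
`|u| ≲ (1+t)^{α+ρ}(1+s)^{−1/2}`. -/
theorem stmt8 (ρ α β : ℝ) (hρ : 0 < ρ) (hα : 0 ≤ α) (hαβ : α ≤ β) (hβα : ρ ≤ β - α)
    (u f : Pt → ℝ) (C0 : ℝ) (hu : ContDiff ℝ (⊤ : ℕ∞) u)
    (heq : ∀ p : Pt, Box u p = f p)
    (hd0 : ∀ x : ℝ × ℝ, u (0, x.1, x.2) = 0)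
    (hd1 : ∀ x : ℝ × ℝ, pd e0 u (0, x.1, x.2) = 0)
    (hfneg : ∀ p : Pt, 0 ≤ p.1 → qvar p < 0 →
      |f p| ≤ C0 * (1 + svar p) ^ (-(3 : ℝ) / 2 + α) * (1 + |qvar p|)⁻¹)
    (hfpos : ∀ p : Pt, 0 ≤ p.1 → 0 < qvar p →
      |f p| ≤ C0 * (1 + svar p) ^ (-(3 : ℝ) / 2 + α) * (1 + |qvar p|) ^ (-1 - β)) :
    ∃ C : ℝ, ∀ p : Pt, 0 ≤ p.1 →
      |u p| ≤ C * (1 + p.1) ^ (α + ρ) * (1 + svar p) ^ (-(1 : ℝ) / 2) := by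
  have hu2 : ContDiff ℝ 2 u := contDiff_infty.1 hu 2
  have hfB : f = Box u := by funext p; exact (heq p).symm
  have hfc : Continuous f := hfB ▸ Box_cont u hu2
  obtain ⟨ε, hε, hε1, hε2⟩ : ∃ ε : ℝ, 0 < ε ∧ ε ≤ 1/12 ∧ 2 * ε ≤ ρ :=
    ⟨min (ρ/2) (1/12), by positivity, min_le_right _ _, by linarith [min_le_left (ρ/2) (1/12)]⟩
  obtain ⟨k, hk⟩ : ∃ k : ℝ, k = 1/2 - ε := ⟨_, rfl⟩
  have h5 : 5 * ε ≤ k := by linarith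
  obtain ⟨Cb, hCb, hbd⟩ := bdry ε hε hε1
  have hpi := Real.pi_pos
  have hpi3 := Real.pi_gt_three
  have hC := abs_nonneg C0
  have hCle := le_abs_self C0
  set A1 : ℝ := |C0| * 3 ^ α * (9 / ε ^ 2) with hA1
  have hA10 : 0 ≤ A1 := by positivity
  have hcase1 : ∀ p : Pt, 0 ≤ p.1 → rad p ≤ 2 * p.1 →
      |u p| ≤ (3 * (A1 * (2 + Cb))) * (1 + p.1) ^ (α + ρ) * (1 + svar p) ^ (-(1 : ℝ) / 2) := by
    rintro ⟨t0, x1, x2⟩ ht hr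
    simp only at ht hr ⊢
    set r0 := rad (t0, x1, x2) with hr0
    have hr00 : 0 ≤ r0 := rad_nonneg _
    obtain ⟨a1, a2, ha, hx1, hx2⟩ := frame x1 x2
    have hx1' : x1 = r0 * a1 := hx1
    have hx2' : x2 = r0 * a2 := hx2
    have hbb := VV_bdint ε k hε hk h5 t0 r0 a1 a2 _ ht ha (hbd t0 r0 ht hr00)
    rw [← hx1', ← hx2'] at hbb
    have hcmp := compare_u u (VV ε k) hu2 (VV_contDiff ε k) hd0 hd1 t0 x1 x2 a1 a2 
      (A1 * (1 + t0) ^ α) _ ht ha (by positivity) (by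
        intro p h0 h1 h2
        have htri := rad_tri p x1 x2 (t0 - p.1) (by linarith) h2 t0
        rw [heq p]
        have hs0 : 0 ≤ svar p := add_nonneg h0 (rad_nonneg p)
        have hs3 : 1 + svar p ≤ 3 * (1 + t0) := by
          unfold svar; linarith [htri.1]
        have hsα : (1 + svar p) ^ (-(3:ℝ)/2 + α) ≤ (1 + svar p) ^ (-(3:ℝ)/2) * (3 ^ α * (1 + t0) ^ α) := by
          rw [Real.rpow_add (by linarith), ← Real.mul_rpow (by norm_num) (by linarith)]
          gcongr
        have hgen : ∀ m : ℝ, 0 ≤ m → |f p| ≤ C0 * (1 + svar p) ^ (-(3:ℝ)/2 + α) * m → 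
            ε ^ 2 / 9 * ((1 + svar p) ^ (-(3:ℝ)/2) * m) ≤ - Box (VV ε k) p →
            |f p| ≤ A1 * (1 + t0) ^ α * (-Box (VV ε k) p) := by
          intro m hm g1 g2
          calc |f p| ≤ C0 * (1 + svar p) ^ (-(3:ℝ)/2 + α) * m := g1
            _ ≤ |C0| * ((1 + svar p) ^ (-(3:ℝ)/2) * (3 ^ α * (1 + t0) ^ α)) * m := by gcongr
            _ = A1 * (1 + t0) ^ α * (ε ^ 2 / 9 * ((1 + svar p) ^ (-(3:ℝ)/2) * m)) := by
                rw [hA1]; field_simp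
            _ ≤ _ := by gcongr
        rcases lt_or_ge (qvar p) 0 with hq | hq
        · exact hgen _ (by positivity) (hfneg p h0 hq) (src_neg ε k hε hk h5 p h0 hq)
        · refine hgen ((1 + |qvar p|) ^ (-1 - ε)) (by positivity) ?_ (src_pos ε k hε hk h5 p h0 hq)
          have g1 := ext0 f hfc C0 _ _ hfpos p h0 hq
          have g2 : |f p| ≤ |C0| * (1 + svar p) ^ (-(3:ℝ)/2 + α) * (1 + |qvar p|) ^ (-1 - β) := 
            g1.trans (by gcongr)
          by_cases hC0 : 0 ≤ C0
          · refine g1.trans ?_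
            gcongr
            · linarith [abs_nonneg (qvar p)]
            · linarith
          · exfalso
            have : C0 * (1 + svar p) ^ (-(3:ℝ)/2 + α) * (1 + |qvar p|) ^ (-1 - β) < 0 := by
              have a1 : 0 < (1 + svar p) ^ (-(3:ℝ)/2 + α) := by positivity
              have a2 : 0 < (1 + |qvar p|) ^ (-1 - β) := by positivity
              exact mul_neg_of_neg_of_pos (mul_neg_of_neg_of_pos (not_le.1 hC0) a1) a2
            linarith [abs_nonneg (f p)]) hbb
    have hup := VV_upper ε k hε hk h5 (t0, x1, x2) ht
    simp only at hup
    set P := (1 + t0) ^ (-(1:ℝ)/2 + 2 * ε) with hP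
    have hP0 : 0 < P := by positivity
    set Aα := A1 * (1 + t0) ^ α with hAα
    have hAα0 : 0 ≤ Aα := by positivity
    have hmain : |u (t0, x1, x2)| ≤ Aα * (2 + Cb) * P := by
      have h1 : Aα * (2 * Real.pi * VV ε k (t0, x1, x2) + Cb * P) ≤ 
          Aα * (2 * Real.pi * (2 * P) + 2 * Real.pi * (Cb * P)) := by
        have : Cb * P ≤ 2 * Real.pi * (Cb * P) := by
          have : 0 ≤ Cb * P := by positivity
          nlinarith
        gcongr
      have h2 : Aα * (2 * Real.pi * (2 * P) + 2 * Real.pi * (Cb * P)) = 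
          2 * Real.pi * (Aα * (2 + Cb) * P) := by ring
      have h3 := hcmp.trans (h1.trans_eq h2)
      exact le_of_mul_le_mul_left h3 (by positivity)
    have hsv : svar (t0, x1, x2) = t0 + r0 := rfl
    have h3 : (1 + t0) ^ (-(1:ℝ)/2) ≤ 3 * (1 + svar (t0, x1, x2)) ^ (-(1:ℝ)/2) := by
      rw [hsv]; exact third _ _ (by linarith) (by linarith) (by linarith)
    have h4 : (1 + t0) ^ α * P ≤ (1 + t0) ^ (α + ρ) * (1 + t0) ^ (-(1:ℝ)/2) := by
      rw [hP, ← Real.rpow_add (by linarith), ← Real.rpow_add (by linarith)]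
      exact Real.rpow_le_rpow_of_exponent_le (by linarith) (by linarith)
    calc _ ≤ Aα * (2 + Cb) * P := hmain
      _ = A1 * (2 + Cb) * ((1 + t0) ^ α * P) := by rw [hAα]; ring
      _ ≤ A1 * (2 + Cb) * ((1 + t0) ^ (α + ρ) * (3 * (1 + svar (t0, x1, x2)) ^ (-(1:ℝ)/2))) := by
          exact mul_le_mul_of_nonneg_left (h4.trans (mul_le_mul_of_nonneg_left h3 (by positivity))) (by positivity)
      _ = _ := by ring
  have hcase2 : ∀ p : Pt, 0 ≤ p.1 → 2 * p.1 < rad p →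
      |u p| ≤ (3 * (|C0| * 4 ^ α)) * (1 + p.1) ^ (α + ρ) * (1 + svar p) ^ (-(1 : ℝ) / 2) := by
    rintro ⟨t0, x1, x2⟩ ht hr
    simp only at ht hr ⊢
    set r0 := rad (t0, x1, x2) with hr0
    have hr00 : 0 ≤ r0 := rad_nonneg _
    have hrp : 0 < 1 + r0 / 2 := by linarith
    set K := |C0| * 4 ^ α * (1 + r0 / 2) ^ (-(5:ℝ)/2) with hK
    have hK0 : 0 ≤ K := by positivity
    have hcmp := compare_u u (fun p => p.1 ^ 2 / 2) hu2 (by fun_prop) hd0 hd1 t0 x1 x2 1 0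
      K 0 ht (by norm_num) hK0 (by
        intro p h0 h1 h2
        have htri := rad_tri p x1 x2 (t0 - p.1) (by linarith) h2 t0
        rw [Box_sq, heq p]
        have hq : r0 / 2 ≤ qvar p := by unfold qvar; linarith [htri.2]
        have hq0 : 0 < qvar p := by linarith
        have hsq : 1 + svar p ≤ 4 * (1 + qvar p) := by
          have : svar p ≤ t0 + r0 := by unfold svar; linarith [htri.1]
          linarith
        have hs : r0 / 2 ≤ svar p := by unfold svar qvar at *; linarith
        have hsp : 0 < 1 + svar p := by linarith
        have g := hfpos p h0 hq0
        rw [abs_of_pos hq0] at g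
        have i1 : (1 + svar p) ^ (-(3:ℝ)/2) ≤ (1 + r0 / 2) ^ (-(3:ℝ)/2) :=
          Real.rpow_le_rpow_of_nonpos hrp (by linarith) (by norm_num)
        have i2 : (1 + svar p) ^ α ≤ 4 ^ α * (1 + qvar p) ^ α := by
          rw [← Real.mul_rpow (by norm_num) (by linarith)]
          gcongr
        have i3 : (1 + qvar p) ^ α * (1 + qvar p) ^ (-1 - β) ≤ (1 + r0 / 2) ^ (-1:ℝ) := by
          rw [← Real.rpow_add (by linarith)]
          calc _ ≤ (1 + qvar p) ^ (-1:ℝ) := Real.rpow_le_rpow_of_exponent_le (by linarith) (by linarith)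
            _ ≤ _ := Real.rpow_le_rpow_of_nonpos hrp (by linarith) (by norm_num)
        have hq1 : 0 < 1 + qvar p := by linarith
        calc |f p| ≤ C0 * (1 + svar p) ^ (-(3:ℝ)/2 + α) * (1 + qvar p) ^ (-1 - β) := g
          _ ≤ |C0| * (1 + svar p) ^ (-(3:ℝ)/2 + α) * (1 + qvar p) ^ (-1 - β) := by gcongr
          _ = |C0| * ((1 + svar p) ^ (-(3:ℝ)/2) * (1 + svar p) ^ α) * (1 + qvar p) ^ (-1 - β) := by
              rw [← Real.rpow_add hsp]
          _ ≤ |C0| * ((1 + r0 / 2) ^ (-(3:ℝ)/2) * (4 ^ α * (1 + qvar p) ^ α)) * (1 + qvar p) ^ (-1 - β) := by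
              gcongr
          _ = |C0| * 4 ^ α * ((1 + r0 / 2) ^ (-(3:ℝ)/2) * ((1 + qvar p) ^ α * (1 + qvar p) ^ (-1 - β))) := by
              ring
          _ ≤ |C0| * 4 ^ α * ((1 + r0 / 2) ^ (-(3:ℝ)/2) * (1 + r0 / 2) ^ (-1:ℝ)) := by gcongr
          _ = K * (- -1) := by
              rw [← Real.rpow_add hrp, hK]; norm_num) (by
        rw [neg_zero]
        apply intervalIntegral.integral_nonneg hpi.le
        intro φ hφ
        apply intervalIntegral.integral_nonneg hpi.le
        intro θ hθ
        apply mul_nonneg (Real.sin_nonneg_of_mem_Icc hφ)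
        have e : ∀ y1 y2 o1 o2 : ℝ, fderiv ℝ (fun p : Pt => p.1 ^ 2 / 2) (0, y1, y2) (1, o1, o2) = 0 := by
          intro y1 y2 o1 o2
          have hf1 : HasFDerivAt (fun p : Pt => p.1) (ContinuousLinearMap.fst ℝ ℝ (ℝ × ℝ)) (0, y1, y2) := 
            hasFDerivAt_fst
          have hf2 := (hf1.mul hf1).mul_const (1/2 : ℝ)
          have : (fun p : Pt => p.1 ^ 2 / 2) = fun p : Pt => (p.1 * p.1) * (1/2) := by
            funext p; ring
          rw [this]
          erw [hf2.fderiv]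
          simp
        unfold X om
        rw [sub_self, e]
        simp)
    have hmain : |u (t0, x1, x2)| ≤ K * (t0 ^ 2 / 2) := by
      have h3 : 2 * Real.pi * |u (t0, x1, x2)| ≤ 2 * Real.pi * (K * (t0 ^ 2 / 2)) := by
        refine hcmp.trans (le_of_eq ?_); ring
      exact le_of_mul_le_mul_left h3 (by positivity)
    have hsv : svar (t0, x1, x2) = t0 + r0 := rfl
    have h3 : (1 + r0 / 2) ^ (-(1:ℝ)/2) ≤ 3 * (1 + svar (t0, x1, x2)) ^ (-(1:ℝ)/2) := by
      rw [hsv]; exact third _ _ (by linarith) (by linarith) (by linarith)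
    have hs0 : 0 ≤ svar (t0, x1, x2) := by rw [hsv]; linarith
    have h4 : 1 ≤ (1 + t0) ^ (α + ρ) := Real.one_le_rpow (by linarith) (by linarith)
    have h6 : t0 ^ 2 / 2 ≤ (1 + r0 / 2) ^ (2:ℝ) := by
      rw [Real.rpow_two]; nlinarith
    calc _ ≤ K * (t0 ^ 2 / 2) := hmain
      _ ≤ K * (1 + r0 / 2) ^ (2:ℝ) := by gcongr
      _ = |C0| * 4 ^ α * (1 + r0 / 2) ^ (-(1:ℝ)/2) := by
          rw [hK, mul_assoc, ← Real.rpow_add hrp]; norm_num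
      _ ≤ |C0| * 4 ^ α * (3 * (1 + svar (t0, x1, x2)) ^ (-(1:ℝ)/2)) := by gcongr
      _ = (3 * (|C0| * 4 ^ α)) * 1 * (1 + svar (t0, x1, x2)) ^ (-(1:ℝ)/2) := by ring
      _ ≤ _ := by gcongr
  refine ⟨3 * (A1 * (2 + Cb)) + 3 * (|C0| * 4 ^ α), fun p hp => ?_⟩
  have hs0 : 0 ≤ svar p := add_nonneg hp (rad_nonneg p)
  have hn1 : 0 ≤ 3 * (A1 * (2 + Cb)) := by positivity
  have hn2 : 0 ≤ 3 * (|C0| * 4 ^ α) := by positivity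
  rcases le_or_gt (rad p) (2 * p.1) with h | h
  · refine (hcase1 p hp h).trans ?_
    gcongr
    linarith
  · refine (hcase2 p hp h).trans ?_
    gcongr
    linarith

end
end
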